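/- arXiv:2506.23064 — 2 statements merged into one kernel-verified Lean document; each statement's English description precedes it below -/
import Mathlib

section
/- Let λ ∈ ℂ, a, N ∈ ℕ and m ∈ ℤ with m > N and a ≥ m−N, and fix q_N^+ ∈ ℂ. Say a polynomial f_j ∈ ℂ[t] satisfies (E_j^+) if (-i)^{N-j} ((2N)!/(N+j)!) Γ_j^+ · f_j(t) = q_N^+ Σ_{r=0}^{N-j} C_{j,r}^+ C̃_{a+m-2N+j+2r}^{λ+N-1-r}(it). Let 1 ≤ j ≤ N-1 and suppose f_j and f_{j+1} satisfy (E_j^+) and (E_{j+1}^+), and that Γ_{j-1}^+ ≠ 0. Then a polynomial f_{j-1} ∈ Pol_{a-m+j-1}[t]_even satisfies the equations S_{a+m-j+1}^{λ+j-2} f_{j-1} - 2(N-j+1) f_j' = 0 and 2(-m(λ+a-1) + j(λ-1+ϑ_t)) f_j + (N-j) f_{j+1}' + (N+j) f_{j-1}' = 0 if and only if f_{j-1} satisfies (E_{j-1}^+). -/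
noncomputable section

open Polynomial Finset

/-- The space `Pol_b[t]_even`: span of the monomials `t^(b-2i)`, `0 ≤ i ≤ ⌊b/2⌋`
(zero space when `b < 0`). -/
def polEven (b : ℤ) (f : ℂ[X]) : Prop :=
  ∀ n : ℕ, f.coeff n ≠ 0 → (n : ℤ) ≤ b ∧ (2 : ℤ) ∣ (b - n)

/-- Imaginary Gegenbauer operator `S_ℓ^μ`. -/
def gegenS (μ : ℂ) (ℓ : ℤ) (f : ℂ[X]) : ℂ[X] :=
  -((1 + X ^ 2) * derivative (derivative f)
      + (1 + 2 * C μ) * X * derivative f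
      - C ((ℓ : ℂ) * ((ℓ : ℂ) + 2 * μ)) * f)

/-- Euler operator `ϑ_t`. -/
def euler (f : ℂ[X]) : ℂ[X] := X * derivative f

/-- Renormalized Gegenbauer polynomial `C̃_n^μ(z)` for a natural number degree `n`. -/
def gegenC (μ : ℂ) (n : ℕ) : ℂ[X] :=
  ∑ k ∈ range (n / 2 + 1),
    C ((-1 : ℂ) ^ k / ((k.factorial : ℂ) * ((n - 2 * k).factorial : ℂ)) *
        ∏ s ∈ range (n / 2 - k), (μ + (((n + 1) / 2 : ℕ) : ℂ) + (s : ℂ))) *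
      (C 2 * X) ^ (n - 2 * k)

/-- `C̃_ℓ^μ(z)` for `ℓ : ℤ` (zero for `ℓ < 0`). -/
def gegenCZ (μ : ℂ) (ℓ : ℤ) : ℂ[X] := if 0 ≤ ℓ then gegenC μ ℓ.toNat else 0

/-- `C̃_ℓ^μ(it)`: substitution `z = it`. -/
def gegenCit (μ : ℂ) (ℓ : ℤ) : ℂ[X] := (gegenCZ μ ℓ).comp (C Complex.I * X)

/-- `γ(μ, ℓ)`. -/
def gam (μ : ℂ) (ℓ : ℤ) : ℂ := if ℓ % 2 = 0 then μ + ((ℓ / 2 : ℤ) : ℂ) else 1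

/-- `Γ(x+k)/Γ(x)` interpreted as a finite product (reciprocal for `k < 0`). -/
def gratio (x : ℂ) (k : ℤ) : ℂ :=
  if 0 ≤ k then ∏ i ∈ range k.toNat, (x + (i : ℂ))
  else (∏ i ∈ range (-k).toNat, (x + (k : ℂ) + (i : ℂ)))⁻¹

/-- `Γ(z₁)/Γ(z₂)` at integer arguments, as a finite product. -/
def gq (z₁ z₂ : ℤ) : ℂ := gratio (z₂ : ℂ) (z₁ - z₂)

/-- The set `Λ(N,a,m)`, regarded as a subset of `ℂ`. -/
def LambdaSet (N a : ℕ) (m : ℤ) : Set ℂ :=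
  { x | ∃ q : ℤ, max 0 ((N : ℤ) - a + m) ≤ q ∧ q ≤ 2 * N ∧
      x = (N : ℂ) + 1 - (a : ℂ) - (q : ℂ) }

/-- The set `M_ℓ^k`, regarded as a subset of `ℂ`. -/
def Mset (ℓ k : ℤ) : Set ℂ :=
  { x | ∃ d : ℤ, 0 ≤ d ∧ d ≤ ℓ / 2 - k - 1 ∧ x = -(((ℓ + 1) / 2 : ℤ) : ℂ) - (d : ℂ) }

/-- The solution space `Ξ(λ,a,N,m)` of the system (A_j^±), (B_j^±), realized as
the set of tuples `(f_{-N},…,f_N)`, encoded as functions `ℤ → ℂ[X]` vanishing for `|j| > N`. -/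
def XiSet (lam : ℂ) (a N : ℕ) (m : ℤ) : Set (ℤ → ℂ[X]) :=
  { f |
    (∀ j : ℤ, (N : ℤ) < |j| → f j = 0) ∧
    (∀ j : ℤ, |j| ≤ (N : ℤ) → polEven ((a : ℤ) - m + j) (f j)) ∧
    (∀ j : ℤ, 0 ≤ j → j ≤ (N : ℤ) →
      gegenS (lam + (j : ℂ) - 1) ((a : ℤ) + m - j) (f j)
        - C (2 * ((N : ℂ) - (j : ℂ))) * derivative (f (j + 1)) = 0) ∧
    (∀ j : ℤ, 0 ≤ j → j ≤ (N : ℤ) →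
      gegenS (lam + (j : ℂ) - 1) ((a : ℤ) - m - j) (f (-j))
        + C (2 * ((N : ℂ) - (j : ℂ))) * derivative (f (-j - 1)) = 0) ∧
    (∀ j : ℤ, 1 ≤ j → j ≤ (N : ℤ) →
      C (2 * (-(m : ℂ)) * (lam + (a : ℂ) - 1)) * f j
        + C (2 * (j : ℂ)) * (C (lam - 1) * f j + euler (f j))
        + C ((N : ℂ) - (j : ℂ)) * derivative (f (j + 1))
        + C ((N : ℂ) + (j : ℂ)) * derivative (f (j - 1)) = 0) ∧
    (∀ j : ℤ, 1 ≤ j → j ≤ (N : ℤ) →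
      C (2 * (m : ℂ) * (lam + (a : ℂ) - 1)) * f (-j)
        + C (2 * (j : ℂ)) * (C (lam - 1) * f (-j) + euler (f (-j)))
        - C ((N : ℂ) + (j : ℂ)) * derivative (f (-j + 1))
        - C ((N : ℂ) - (j : ℂ)) * derivative (f (-j - 1)) = 0) }

/-- The constant `C_{j,r}^+`. -/
def Cp (lam : ℂ) (a N : ℕ) (m : ℤ) (j r : ℕ) : ℂ :=
  ((N - j).choose r : ℂ) * (((2 * N - r).factorial : ℂ) / ((N + j).factorial : ℂ)) *
    (∏ i ∈ range r, ((N : ℂ) - (m : ℂ) - (i : ℂ))) *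
    (∏ i ∈ range r, (lam + (a : ℂ) - (N : ℂ) - 1 + (i : ℂ)))

/-- The constant `C_{j,r}^-`. -/
def Cm (lam : ℂ) (a N : ℕ) (m : ℤ) (j r : ℕ) : ℂ :=
  ((N - j).choose r : ℂ) * (((2 * N - r).factorial : ℂ) / ((N + j).factorial : ℂ)) *
    (∏ i ∈ range r, ((N : ℂ) + (m : ℂ) - (i : ℂ))) *
    (∏ i ∈ range r, (lam + (a : ℂ) - (N : ℂ) - 1 + (i : ℂ)))

/-- The gamma factor `Γ_j^+`. -/
def GammaP (lam : ℂ) (a N : ℕ) (m : ℤ) (j : ℕ) : ℂ :=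
  ∏ d ∈ range (N - j), gam (lam + (N : ℂ) - 1) ((a : ℤ) + m - (N : ℤ) - ((d : ℤ) + 1))

/-- The gamma factor `Γ_j^-`. -/
def GammaM (lam : ℂ) (a N : ℕ) (m : ℤ) (j : ℕ) : ℂ :=
  ∏ d ∈ range (N - j), gam (lam + (N : ℂ) - 1) ((a : ℤ) - m - (N : ℤ) - ((d : ℤ) + 1))

/-- The constant `D_{j,r}` (with parameter `q`). -/
def Dc (N : ℕ) (m q : ℤ) (j r : ℕ) : ℂ :=
  ((N - j).choose r : ℂ) * (((2 * N - r).factorial : ℂ) / ((N + j).factorial : ℂ)) *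
    (∏ i ∈ range r, ((N : ℂ) + (m : ℂ) - (i : ℂ))) *
    (∏ i ∈ range r, ((q : ℂ) - 2 * (N : ℂ) + (i : ℂ)))

/-- Binomial coefficient with integer upper argument: `binom(x,k) = (∏_{i<k}(x-i))/k!`. -/
def zbinom (x : ℤ) (k : ℕ) : ℂ := (∏ i ∈ range k, ((x : ℂ) - (i : ℂ))) / (k.factorial : ℂ)

/-- The gamma factor `Γ(d,r)` of the paper (for integral `λ = λz`, `ν = νz`). -/
def GammaAB (N : ℕ) (m lamz nuz : ℤ) (d r : ℕ) : ℂ :=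
  (d.choose r : ℂ) *
    gq (lamz + (nuz - lamz - m + (N : ℤ) - (d : ℤ) - 1) / 2)
       (lamz + (nuz - lamz - m - 1) / 2) *
    (((2 * N - r).factorial : ℂ) / (N.factorial : ℂ)) *
    (∏ i ∈ range r, ((N : ℂ) + (m : ℂ) - (i : ℂ)))

/-- The constant `A(d,r)` of the paper (for integral `λ = λz`, `ν = νz`). -/
def Acoef (N : ℕ) (m lamz nuz : ℤ) (d r : ℕ) : ℂ :=
  (-1 : ℂ) ^ (nuz - 1) * GammaAB N m lamz nuz d r *
    gq (lamz + (-nuz - lamz - m + (N : ℤ) - (d : ℤ) + 1) / 2)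
       (lamz + (nuz - lamz - m + (N : ℤ) - (d : ℤ) - 1) / 2) *
    ∏ i ∈ range r, ((N : ℂ) + (nuz : ℂ) - ((i : ℂ) + 1))

/-- The constant `B(d,r)` of the paper (for integral `λ = λz`, `ν = νz`). -/
def Bcoef (N : ℕ) (m lamz nuz : ℤ) (d r : ℕ) : ℂ :=
  (-1 : ℂ) ^ ((d : ℤ) - (N : ℤ)) * GammaAB N m lamz nuz (2 * N - d) r *
    ∏ i ∈ range r, ((N : ℂ) - (nuz : ℂ) + 2 - ((i : ℂ) + 1))

/-- The predicate `(E_j^+)` on `f_j`. -/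
def Eplus (lam : ℂ) (a N : ℕ) (m : ℤ) (qp : ℂ) (j : ℕ) (fj : ℂ[X]) : Prop :=
  C ((-Complex.I) ^ (N - j) * (((2 * N).factorial : ℂ) / ((N + j).factorial : ℂ)) *
      GammaP lam a N m j) * fj
    = C qp * ∑ r ∈ range (N - j + 1),
        C (Cp lam a N m j r) *
          gegenCit (lam + (N : ℂ) - 1 - (r : ℂ)) ((a : ℤ) + m - 2 * (N : ℤ) + (j : ℤ) + 2 * (r : ℤ))

/-- The predicate `(E_j^-)` on `f_{-j}`. -/
def Eminus (lam : ℂ) (a N : ℕ) (m : ℤ) (qm : ℂ) (j : ℕ) (fj : ℂ[X]) : Prop :=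
  C (Complex.I ^ (N - j) * (((2 * N).factorial : ℂ) / ((N + j).factorial : ℂ)) *
      GammaM lam a N m j) * fj
    = C qm * ∑ r ∈ range (N - j + 1),
        C (Cm lam a N m j r) *
          gegenCit (lam + (N : ℂ) - 1 - (r : ℂ)) ((a : ℤ) - m - 2 * (N : ℤ) + (j : ℤ) + 2 * (r : ℤ))

/-- The constant `C_{0,r}(m')` with integer parameter `a`. -/
def C0r (lam : ℂ) (N : ℕ) (a m' : ℤ) (r : ℕ) : ℂ :=
  (N.choose r : ℂ) * (((2 * N - r).factorial : ℂ) / (N.factorial : ℂ)) *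
    (∏ i ∈ range r, ((N : ℂ) - (m' : ℂ) - (i : ℂ))) *
    (∏ i ∈ range r, (lam + (a : ℂ) - (N : ℂ) - 1 + (i : ℂ)))

/-- `α(λ,N,a,m')`. -/
def alphaF (lam : ℂ) (N : ℕ) (a m' : ℤ) : ℂ :=
  ∑ r ∈ range (N + 1), (-1 : ℂ) ^ r * C0r lam N a m' r *
    ∏ i ∈ range (N - r), ((((a + m') / 2 : ℤ) : ℂ) - ((i : ℂ) + 1))

/-- `β(λ,N,a,m')`. -/
def betaF (lam : ℂ) (N : ℕ) (a m' : ℤ) : ℂ :=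
  ∑ r ∈ range (N + 1), (-1 : ℂ) ^ r * C0r lam N a m' r *
    ∏ i ∈ range (N - r), ((((a + m' + 2) / 2 : ℤ) : ℂ) - ((i : ℂ) + 1))

/-- The polynomial function `P(λ)`. -/
def Pf (N : ℕ) (a m : ℤ) (lam : ℂ) : ℂ :=
  (lam + (((a + m - 1) / 2 : ℤ) : ℂ)) * (((a + m) / 2 : ℤ) : ℂ) *
      alphaF lam N a m * betaF lam N a (-m)
    - (lam + (((a - m - 1) / 2 : ℤ) : ℂ)) * (((a - m) / 2 : ℤ) : ℂ) *
      alphaF lam N a (-m) * betaF lam N a m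

/-- The polynomial function `Q(λ)`. -/
def Qf (N : ℕ) (a m : ℤ) (lam : ℂ) : ℂ :=
  (∏ i ∈ range (N + 1), ((m : ℂ) + (i : ℂ))) *
    (∏ i ∈ range N, (((i : ℂ) + 1) - (m : ℂ))) *
    ∏ q ∈ range (2 * N + 1), (lam - (N : ℂ) - 1 + (a : ℂ) + (q : ℂ))

/-- `α̃(a,m')`. -/
def alphaTilde (N q : ℕ) (a m' : ℤ) : ℂ :=
  ∑ r ∈ range (min q N + 1),
    (N.choose r : ℂ) * (((2 * N - r).factorial : ℂ) / ((2 * N - q).factorial : ℂ)) *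
      ((q.factorial : ℂ) / ((q - r).factorial : ℂ)) *
      (∏ i ∈ range r, ((N : ℂ) - (m' : ℂ) - (i : ℂ))) *
      (∏ i ∈ Finset.Ico r q, ((((a + m') / 2 : ℤ) : ℂ) - (N : ℂ) + (i : ℂ)))

/-- The explicit generating tuple of `Ξ(λ,a,N,m)` of Theorem 4.3 (statement 1). -/
def F1 (N a : ℕ) (m q : ℤ) : ℤ → ℂ[X] := fun j =>
  let lamz : ℤ := (N : ℤ) + 1 - a - q
  let nuz : ℤ := (N : ℤ) + 1 - q
  let lam : ℂ := (lamz : ℂ)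
  if 1 ≤ j ∧ j ≤ (N : ℤ) then
    C (Complex.I ^ (-j) * (-1 : ℂ) ^ (nuz - 1)) *
      ∑ r ∈ range (N - j.toNat + 1),
        C ((-1 : ℂ) ^ r * Acoef N m lamz nuz (N - j.toNat) r) *
          gegenCit (lam + (N : ℂ) - 1 - (r : ℂ))
            ((a : ℤ) - m + j + 2 * (1 - (N : ℤ) - nuz + (r : ℤ)))
  else if -(N : ℤ) ≤ j ∧ j ≤ 0 then
    C (Complex.I ^ j) *
      ∑ r ∈ range (N - (-j).toNat + 1),
        C ((-1 : ℂ) ^ r * Bcoef N m lamz nuz (N + (-j).toNat) r) *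
          gegenCit (lam + (N : ℂ) - 1 - (r : ℂ))
            ((a : ℤ) - m + (-j) - 2 * (N : ℤ) + 2 * (r : ℤ))
  else 0

/-- The explicit tuple of statement 16. -/
def F16 (N a : ℕ) (m q : ℤ) : ℤ → ℂ[X] := fun j =>
  let lam : ℂ := (N : ℂ) + 1 - (a : ℂ) - (q : ℂ)
  if 1 ≤ j ∧ j ≤ (N : ℤ) then
    C ((-Complex.I) ^ j.toNat * (((N + j.toNat).factorial : ℂ) / (N.factorial : ℂ)) *
        gratio (lam + ((((a : ℤ) - m - 1) / 2 : ℤ) : ℂ))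
          (((a : ℤ) - m + j - 1) / 2 + q - (N : ℤ) - ((a : ℤ) - m - 1) / 2)) *
      ∑ r ∈ range (N - j.toNat + 1),
        C (Dc N m q j.toNat r) *
          gegenCit (lam + (N : ℂ) - 1 - (r : ℂ))
            ((a : ℤ) - m + j + 2 * (q - 2 * (N : ℤ) + (r : ℤ)))
  else if -(N : ℤ) ≤ j ∧ j ≤ 0 then
    C (Complex.I ^ (-j).toNat * (((N + (-j).toNat).factorial : ℂ) / (N.factorial : ℂ)) *
        gratio (lam + ((((a : ℤ) - m - 1) / 2 : ℤ) : ℂ))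
          (((a : ℤ) - m + (-j) - 1) / 2 - ((a : ℤ) - m - 1) / 2)) *
      ∑ r ∈ range (N - (-j).toNat + 1),
        C (Cm lam a N m (-j).toNat r) *
          gegenCit (lam + (N : ℂ) - 1 - (r : ℂ))
            ((a : ℤ) - m - 2 * (N : ℤ) + (-j) + 2 * (r : ℤ))
  else 0

theorem gcoef (μ : ℂ) (n p : ℕ) : (gegenC μ n).coeff p =
    ∑ k ∈ range (n / 2 + 1), if p = n - 2 * k then
      ((-1 : ℂ) ^ k / ((k.factorial : ℂ) * ((n - 2 * k).factorial : ℂ)) *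
        ∏ s ∈ range (n / 2 - k), (μ + (((n + 1) / 2 : ℕ) : ℂ) + (s : ℂ))) * 2 ^ (n - 2 * k)
      else 0 := by
  unfold gegenC
  rw [finsetSum_coeff]
  refine Finset.sum_congr rfl fun k _ => ?_
  rw [mul_pow, ← C_pow, ← mul_assoc, ← C_mul, coeff_C_mul_X_pow]

theorem comp_IX_coeff (f : ℂ[X]) (p : ℕ) :
    (f.comp (C Complex.I * X)).coeff p = f.coeff p * Complex.I ^ p :=
  comp_C_mul_X_coeff

theorem coefA (μ : ℂ) (p k : ℕ) (ℓ : ℤ) (hl : ℓ = p + 2 * k) : (gegenCit μ ℓ).coeff p =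
    (-1 : ℂ) ^ k / ((k.factorial : ℂ) * (p.factorial : ℂ)) *
      (∏ s ∈ range (p / 2), (μ + (((p + 2 * k + 1) / 2 : ℕ) : ℂ) + (s : ℂ))) *
        (2 * Complex.I) ^ p := by
  have h0 : 0 ≤ ℓ := by omega
  have h1 : ℓ.toNat = p + 2 * k := by omega
  rw [gegenCit, gegenCZ, if_pos h0, comp_IX_coeff, h1, gcoef,
    Finset.sum_eq_single_of_mem k (Finset.mem_range.2 (by omega))]
  · rw [if_pos (by omega)]
    have e1 : p + 2 * k - 2 * k = p := by omega
    have e2 : (p + 2 * k) / 2 - k = p / 2 := by omega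
    rw [e1, e2]
    ring
  · intro b hb hbk
    rw [if_neg]
    have := Finset.mem_range.1 hb
    omega

theorem coefB (μ : ℂ) (p : ℕ) (ℓ : ℤ) (hl : ∀ k : ℕ, ℓ ≠ p + 2 * k) :
    (gegenCit μ ℓ).coeff p = 0 := by
  rw [gegenCit, gegenCZ, comp_IX_coeff]
  split_ifs with h0
  · rw [gcoef, Finset.sum_eq_zero, zero_mul]
    intro k hk
    have := Finset.mem_range.1 hk
    have := hl k
    rw [if_neg]
    omega
  · simp

/-- Euler relation. -/
theorem gegen_euler (μ : ℂ) (ℓ : ℤ) :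
    X * derivative (gegenCit μ ℓ) = C (ℓ : ℂ) * gegenCit μ ℓ + C 2 * gegenCit (μ + 1) (ℓ - 2) := by
  ext p
  have hX : (X * derivative (gegenCit μ ℓ)).coeff p = p * (gegenCit μ ℓ).coeff p := by
    cases p with
    | zero => simp
    | succ p => rw [coeff_X_mul, coeff_derivative]; push_cast; ring
  rw [hX, coeff_add, coeff_C_mul, coeff_C_mul]
  by_cases h : ∃ k : ℕ, ℓ = p + 2 * k
  · obtain ⟨k, hk⟩ := h
    rw [coefA μ p k ℓ hk]
    cases k with
    | zero =>
      rw [coefB (μ + 1) p (ℓ - 2) (by intro k'; omega), hk]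
      push_cast; ring
    | succ k =>
      rw [coefA (μ + 1) p k (ℓ - 2) (by push_cast at hk; omega), hk]
      have e : (p + 2 * (k + 1) + 1) / 2 = (p + 2 * k + 1) / 2 + 1 := by omega
      rw [e]
      have e2 : ∀ s : ℕ, μ + (((p + 2 * k + 1) / 2 + 1 : ℕ) : ℂ) + (s : ℂ)
          = μ + 1 + (((p + 2 * k + 1) / 2 : ℕ) : ℂ) + (s : ℂ) := by
        intro s; push_cast; ring
      simp only [e2]
      rw [Nat.factorial_succ]
      have h1 : (k.factorial : ℂ) ≠ 0 := by exact_mod_cast k.factorial_ne_zero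
      have h2 : (p.factorial : ℂ) ≠ 0 := by exact_mod_cast p.factorial_ne_zero
      have h3 : (k : ℂ) + 1 ≠ 0 := by exact_mod_cast k.succ_ne_zero
      push_cast
      field_simp
      ring
  · push Not at h
    rw [coefB μ p ℓ h, coefB (μ + 1) p (ℓ - 2)]
    · simp
    · intro k hk
      exact h (k + 1) (by push_cast; omega)

/-- Derivative relation. -/
theorem gegen_deriv (μ : ℂ) (ℓ : ℤ) :
    derivative (gegenCit μ ℓ) = C (2 * Complex.I * gam μ ℓ) * gegenCit (μ + 1) (ℓ - 1) := by
  ext p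
  rw [coeff_derivative, coeff_C_mul]
  by_cases h : ∃ k : ℕ, ℓ = (p + 1 : ℕ) + 2 * k
  · obtain ⟨k, hk⟩ := h
    rw [coefA μ (p + 1) k ℓ hk, coefA (μ + 1) p k (ℓ - 1) (by push_cast at hk; omega)]
    have h1 : (k.factorial : ℂ) ≠ 0 := by exact_mod_cast k.factorial_ne_zero
    have h2 : (p.factorial : ℂ) ≠ 0 := by exact_mod_cast p.factorial_ne_zero
    have h3 : (p : ℂ) + 1 ≠ 0 := by exact_mod_cast p.succ_ne_zero
    have key : ∏ s ∈ range ((p + 1) / 2), (μ + (((p + 1 + 2 * k + 1) / 2 : ℕ) : ℂ) + (s : ℂ))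
        = gam μ ℓ * ∏ s ∈ range (p / 2), (μ + 1 + (((p + 2 * k + 1) / 2 : ℕ) : ℂ) + (s : ℂ)) := by
      obtain ⟨s, hs | hs⟩ := p.even_or_odd'
      · subst hs
        rw [gam, if_neg (by push_cast at hk; omega), one_mul]
        have e1 : (2 * s + 1) / 2 = s := by omega
        have e2 : (2 * s) / 2 = s := by omega
        have e3 : (2 * s + 1 + 2 * k + 1) / 2 = s + k + 1 := by omega
        have e4 : (2 * s + 2 * k + 1) / 2 = s + k := by omega
        rw [e1, e2, e3, e4]
        refine Finset.prod_congr rfl fun i _ => ?_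
        push_cast; ring
      · subst hs
        rw [gam, if_pos (by push_cast at hk; omega)]
        have e1 : (2 * s + 1 + 1) / 2 = s + 1 := by omega
        have e2 : (2 * s + 1) / 2 = s := by omega
        have e3 : (2 * s + 1 + 1 + 2 * k + 1) / 2 = s + k + 1 := by omega
        have e4 : (2 * s + 1 + 2 * k + 1) / 2 = s + k + 1 := by omega
        have e5 : ℓ / 2 = s + k + 1 := by push_cast at hk; omega
        rw [e1, e2, e3, e4, e5, Finset.prod_range_succ', mul_comm]
        congr 1
        · push_cast; ring
        · refine Finset.prod_congr rfl fun i _ => ?_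
          push_cast; ring
    rw [key, Nat.factorial_succ]
    push_cast
    field_simp
    ring
  · push Not at h
    rw [coefB μ (p + 1) ℓ h, coefB (μ + 1) p (ℓ - 1)]
    · simp
    · intro k hk
      exact h k (by push_cast; omega)

theorem gam_mul (μ : ℂ) (ℓ : ℤ) :
    gam μ ℓ * gam μ (ℓ + 1) = μ + (((ℓ + 1) / 2 : ℤ) : ℂ) := by
  unfold gam
  by_cases h : ℓ % 2 = 0
  · rw [if_pos h, if_neg (by omega), mul_one]
    congr 2; omega
  · rw [if_neg h, if_pos (by omega), one_mul]

theorem gam_shift (μ : ℂ) (ℓ : ℤ) (r : ℕ) : gam (μ - r) (ℓ + 2 * r) = gam μ ℓ := by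
  unfold gam
  by_cases h : ℓ % 2 = 0
  · rw [if_pos h, if_pos (by omega)]
    have : (ℓ + 2 * r) / 2 = ℓ / 2 + r := by omega
    rw [this]; push_cast; ring
  · rw [if_neg h, if_neg (by omega)]

/-- Three term relation. -/
theorem gegen_three (μ : ℂ) (ℓ : ℤ) :
    C (gam μ ℓ * gam μ (ℓ + 1)) * gegenCit (μ + 1) ℓ
      = C ((ℓ : ℂ) + μ) * gegenCit μ ℓ + gegenCit (μ + 1) (ℓ - 2) := by
  rw [gam_mul]
  ext p
  rw [coeff_add, coeff_C_mul, coeff_C_mul]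
  by_cases h : ∃ k : ℕ, ℓ = p + 2 * k
  · obtain ⟨k, hk⟩ := h
    have h1 : (k.factorial : ℂ) ≠ 0 := by exact_mod_cast k.factorial_ne_zero
    have h2 : (p.factorial : ℂ) ≠ 0 := by exact_mod_cast p.factorial_ne_zero
    have e0 : (ℓ + 1) / 2 = (((p + 2 * k + 1) / 2 : ℕ) : ℤ) := by omega
    rw [coefA μ p k ℓ hk, coefA (μ + 1) p k ℓ hk, e0]
    have hx : (μ + (((p + 2 * k + 1) / 2 : ℕ) : ℂ)) *
          ∏ s ∈ range (p / 2), (μ + 1 + (((p + 2 * k + 1) / 2 : ℕ) : ℂ) + (s : ℂ))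
        = (∏ s ∈ range (p / 2), (μ + (((p + 2 * k + 1) / 2 : ℕ) : ℂ) + (s : ℂ))) *
          (μ + (((p + 2 * k + 1) / 2 : ℕ) : ℂ) + ((p / 2 : ℕ) : ℂ)) := by
      rw [← Finset.prod_range_succ, Finset.prod_range_succ', mul_comm]
      congr 1
      · refine Finset.prod_congr rfl fun i _ => ?_
        push_cast; ring
      · push_cast; ring
    have hy : (((p + 2 * k + 1) / 2 : ℕ) : ℂ) + ((p / 2 : ℕ) : ℂ) = p + k := by
      have : (p + 2 * k + 1) / 2 + p / 2 = p + k := by omega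
      exact_mod_cast this
    have hz : (gegenCit (μ + 1) (ℓ - 2)).coeff p = - k * ((-1 : ℂ) ^ k / ((k.factorial : ℂ) * (p.factorial : ℂ)) *
      (∏ s ∈ range (p / 2), (μ + (((p + 2 * k + 1) / 2 : ℕ) : ℂ) + (s : ℂ))) *
        (2 * Complex.I) ^ p) := by
      have := congrArg (fun f => f.coeff p) (gegen_euler μ ℓ)
      have hX : (X * derivative (gegenCit μ ℓ)).coeff p = p * (gegenCit μ ℓ).coeff p := by
        cases p with
        | zero => simp
        | succ p => rw [coeff_X_mul, coeff_derivative]; push_cast; ring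
      simp only [hX, coeff_add, coeff_C_mul] at this
      rw [coefA μ p k ℓ hk] at this
      have hlc : (ℓ : ℂ) = p + 2 * k := by rw [hk]; push_cast; ring
      rw [hlc] at this
      linear_combination (-1 / 2 : ℂ) * this
    have hlc : (ℓ : ℂ) = p + 2 * k := by rw [hk]; push_cast; ring
    rw [hz, hlc]
    rw [Int.cast_natCast]
    linear_combination ((-1 : ℂ) ^ k / ((k.factorial : ℂ) * (p.factorial : ℂ)) *
        (2 * Complex.I) ^ p) * hx + ((-1 : ℂ) ^ k / ((k.factorial : ℂ) * (p.factorial : ℂ)) *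
        (2 * Complex.I) ^ p) * (∏ s ∈ range (p / 2), (μ + (((p + 2 * k + 1) / 2 : ℕ) : ℂ) + (s : ℂ))) * hy
  · push Not at h
    rw [coefB μ p ℓ h, coefB (μ + 1) p ℓ h, coefB (μ + 1) p (ℓ - 2)]
    · simp
    · intro k hk
      exact h (k + 1) (by push_cast; omega)

theorem gegen_euler2 (μ : ℂ) (ℓ : ℤ) :
    X * derivative (gegenCit μ ℓ) + C ((ℓ : ℂ) + 2 * μ) * gegenCit μ ℓ
      = C (2 * (gam μ ℓ * gam μ (ℓ + 1))) * gegenCit (μ + 1) ℓ := by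
  have h1 := gegen_euler μ ℓ
  have h2 := gegen_three μ ℓ
  simp only [C_mul, C_add] at *
  have h2C : (C (2 : ℂ) : ℂ[X]) = 2 := rfl
  rw [h2C] at h1 ⊢
  linear_combination h1 - 2 * h2

theorem gegen_S (μ : ℂ) (ℓ : ℤ) : gegenS μ ℓ (gegenCit μ ℓ) = 0 := by
  have h1 := gegen_euler2 μ ℓ
  have h2 := gegen_euler (μ + 1) ℓ
  have h3 := gegen_deriv μ ℓ
  have h4 := congrArg derivative h3
  have h5 := gegen_deriv (μ + 1) (ℓ - 1)
  have h6 := congrArg derivative h1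
  have e : gam (μ + 1) (ℓ - 1) = gam μ (ℓ + 1) := by
    have := gam_shift (μ + 1) (ℓ - 1) 1
    rw [← this]; congr 1 <;> push_cast <;> ring
  have e2 : ℓ - 1 - 1 = ℓ - 2 := by ring
  rw [e, e2] at h5
  simp only [derivative_mul, derivative_add, derivative_X, C_mul, C_add] at *
  have h2C : (C (2 : ℂ) : ℂ[X]) = 2 := rfl
  have hI : (C Complex.I : ℂ[X]) * C Complex.I = -1 := by
    rw [← C_mul, Complex.I_mul_I]; simp
  unfold gegenS
  simp only [C_mul, C_add]
  simp only [h2C, derivative_ofNat, derivative_C, zero_mul, zero_add, mul_zero, add_zero] at *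
  linear_combination (-1 : ℂ[X]) * h4 - X * h6 + C (ℓ : ℂ) * h1
    - 2 * C (gam μ ℓ) * C (gam μ (ℓ + 1)) * h2 - 2 * C Complex.I * C (gam μ ℓ) * h5 - 4 * C (gam μ ℓ) * C (gam μ (ℓ + 1)) * gegenCit (μ + 1 + 1) (ℓ - 2) * hI

theorem fact_c (n : ℕ) : ((n + 1).factorial : ℂ) = ((n : ℂ) + 1) * (n.factorial : ℂ) := by
  rw [Nat.factorial_succ]; push_cast; ring

theorem fact_ne (n : ℕ) : (n.factorial : ℂ) ≠ 0 := by exact_mod_cast n.factorial_ne_zero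

theorem cast_ne (n : ℕ) : (n : ℂ) + 1 ≠ 0 := by exact_mod_cast n.succ_ne_zero

theorem choose_low (M r : ℕ) (h : r ≤ M + 1) :
    (((M : ℂ) + 1) - r) * ((M + 1).choose r : ℂ) = ((M : ℂ) + 1) * (M.choose r : ℂ) := by
  have h1 := Nat.choose_mul_succ_eq M r
  have h2 : ((M.choose r * (M + 1) : ℕ) : ℂ) = (((M + 1).choose r * (M + 1 - r) : ℕ) : ℂ) := by
    rw [h1]
  rw [Nat.cast_mul, Nat.cast_mul, Nat.cast_sub h] at h2
  push_cast at h2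
  linear_combination -h2

theorem choose_r (M r : ℕ) (h : r ≤ M) :
    (M.choose (r + 1) : ℂ) * (r + 1) = (M.choose r : ℂ) * (M - r) := by
  have h1 := Nat.choose_succ_right_eq M r
  have h2 : ((M.choose (r + 1) * (r + 1) : ℕ) : ℂ) = ((M.choose r * (M - r) : ℕ) : ℂ) := by
    rw [h1]
  rw [Nat.cast_mul, Nat.cast_mul, Nat.cast_sub h] at h2
  push_cast at h2
  exact h2

/-- The right-hand side sum of `(E_j^+)`. -/
def Fsum (lam : ℂ) (a N : ℕ) (m : ℤ) (j : ℕ) : ℂ[X] :=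
  ∑ r ∈ range (N - j + 1), C (Cp lam a N m j r) *
    gegenCit (lam + (N : ℂ) - 1 - (r : ℂ)) ((a : ℤ) + m - 2 * (N : ℤ) + (j : ℤ) + 2 * (r : ℤ))

theorem gegenS_add (μ : ℂ) (ℓ : ℤ) (f g : ℂ[X]) :
    gegenS μ ℓ (f + g) = gegenS μ ℓ f + gegenS μ ℓ g := by
  unfold gegenS; simp only [derivative_add]; ring

theorem gegenS_C_mul (μ c : ℂ) (ℓ : ℤ) (f : ℂ[X]) :
    gegenS μ ℓ (C c * f) = C c * gegenS μ ℓ f := by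
  unfold gegenS; simp only [derivative_C_mul]; ring

theorem gegenS_sum (μ : ℂ) (ℓ : ℤ) (s : Finset ℕ) (f : ℕ → ℂ[X]) :
    gegenS μ ℓ (∑ r ∈ s, f r) = ∑ r ∈ s, gegenS μ ℓ (f r) := by
  induction s using Finset.cons_induction with
  | empty => simp [gegenS]
  | cons r s hr ih => rw [Finset.sum_cons, Finset.sum_cons, gegenS_add, ih]

theorem gegenS_term (μ : ℂ) (n : ℤ) (M r : ℕ) :
    gegenS (μ - M) (n + 2 * M) (gegenCit (μ - r) (n + 2 * r))
      = C (4 * ((M : ℂ) - r) * (gam μ n * gam μ (n + 1))) * gegenCit (μ - r + 1) (n + 2 * r) := by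
  have h1 := gegen_S (μ - r) (n + 2 * r)
  have h2 := gegen_euler2 (μ - r) (n + 2 * r)
  rw [gam_shift, show n + 2 * (r : ℤ) + 1 = (n + 1) + 2 * r by ring, gam_shift] at h2
  have h2C : (C (2 : ℂ) : ℂ[X]) = 2 := rfl
  have h4C : (C (4 : ℂ) : ℂ[X]) = 4 := rfl
  unfold gegenS at *
  push_cast at *
  simp only [C_mul, C_add, C_sub, h2C, h4C] at *
  linear_combination h1 + 2 * (C (M : ℂ) - C (r : ℂ)) * h2

theorem id1 (lam : ℂ) (a J M : ℕ) (m : ℤ) :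
    gegenS (lam + (J : ℂ) - 1) ((a : ℤ) + m - (J : ℤ)) (Fsum lam a (J + 1 + M) m J)
      = C (2 * ((M : ℂ) + 1) * (-Complex.I) * (((J + 1 + M : ℕ) : ℂ) + J + 1) *
          gam (lam + ((J + 1 + M : ℕ) : ℂ) - 1) ((a : ℤ) + m - 2 * ((J + 1 + M : ℕ) : ℤ) + (J : ℤ))) *
        derivative (Fsum lam a (J + 1 + M) m (J + 1)) := by
  unfold Fsum
  have e1 : J + 1 + M - J + 1 = (M + 1) + 1 := by omega
  have e2 : J + 1 + M - (J + 1) + 1 = M + 1 := by omega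
  rw [e1, e2, gegenS_sum, derivative_sum]
  set μ := lam + ((J + 1 + M : ℕ) : ℂ) - 1 with hμ
  set n := (a : ℤ) + m - 2 * ((J + 1 + M : ℕ) : ℤ) + (J : ℤ) with hn
  have e3 : lam + (J : ℂ) - 1 = μ - ((M + 1 : ℕ) : ℂ) := by rw [hμ]; push_cast; ring
  have e4 : (a : ℤ) + m - (J : ℤ) = n + 2 * ((M + 1 : ℕ) : ℤ) := by rw [hn]; push_cast; ring
  rw [e3, e4]
  simp only [gegenS_C_mul, gegenS_term]
  rw [Finset.sum_range_succ]
  simp only [sub_self, mul_zero, zero_mul, C_0, add_zero]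
  rw [Finset.mul_sum]
  refine Finset.sum_congr rfl fun r hr => ?_
  have hrM : r ≤ M := by have := Finset.mem_range.1 hr; omega
  have e5 : (a : ℤ) + m - 2 * ((J + 1 + M : ℕ) : ℤ) + ((J + 1 : ℕ) : ℤ) + 2 * (r : ℤ)
      = (n + 1) + 2 * r := by rw [hn]; push_cast; ring
  rw [e5, derivative_C_mul, gegen_deriv, gam_shift]
  have e6 : n + 1 + 2 * (r : ℤ) - 1 = n + 2 * r := by ring
  rw [e6]
  simp only [← mul_assoc, ← C_mul]
  congr 2
  have hC : (((M + 1 : ℕ) : ℂ) - r) * Cp lam a (J + 1 + M) m J r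
      = ((M : ℂ) + 1) * (((J + 1 + M : ℕ) : ℂ) + J + 1) * Cp lam a (J + 1 + M) m (J + 1) r := by
    unfold Cp
    have f1 : J + 1 + M - J = M + 1 := by omega
    have f2 : J + 1 + M - (J + 1) = M := by omega
    rw [f1, f2, show J + 1 + M + (J + 1) = (J + 1 + M + J) + 1 by ring, Nat.factorial_succ]
    have hb := choose_low M r (by omega)
    have hf := fact_ne (J + 1 + M + J)
    have hg := cast_ne (J + 1 + M + J)
    generalize (J + 1 + M + J).factorial = f at *
    push_cast at *
    field_simp
    linear_combination ((2 * (J + 1 + M) - r).factorial : ℂ) * (∏ i ∈ range r, ((J : ℂ) + 1 + M - (m : ℂ) - (i : ℂ))) *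
      (∏ i ∈ range r, (lam + (a : ℂ) - ((J : ℂ) + 1 + M) - 1 + (i : ℂ)))  * hb
  linear_combination 4 * gam μ n * gam μ (n + 1) * hC + 4 * ((M : ℂ) + 1) * (((J + 1 + M : ℕ) : ℂ) + J + 1) *
    Cp lam a (J + 1 + M) m (J + 1) r * gam μ n * gam μ (n + 1) * Complex.I_mul_I

theorem Cp_vanish (lam : ℂ) (a N : ℕ) (m : ℤ) (j r : ℕ) (h : N - j < r) : Cp lam a N m j r = 0 := by
  unfold Cp; rw [Nat.choose_eq_zero_of_lt h]; simp

theorem Cp_zero (lam : ℂ) (a J M : ℕ) (m : ℤ) :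
    2 * ((J : ℂ) + 1) * Cp lam a (J + 1 + M) m (J + 1) 0
      + (M : ℂ) * (2 * (J : ℂ) + M + 3) * Cp lam a (J + 1 + M) m (J + 2) 0
      - Cp lam a (J + 1 + M) m J 0 = 0 := by
  unfold Cp
  rw [show J + 1 + M + (J + 2) = ((J + 1 + M + J) + 1) + 1 by ring,
    show J + 1 + M + (J + 1) = (J + 1 + M + J) + 1 by ring, fact_c (J + 1 + M + J + 1), fact_c (J + 1 + M + J)]
  simp only [Nat.choose_zero_right, range_zero, prod_empty]
  have hf := fact_ne (J + 1 + M + J)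
  have hg := cast_ne (J + 1 + M + J)
  have hg2 := cast_ne (J + 1 + M + J + 1)
  generalize (J + 1 + M + J).factorial = f at *
  generalize (2 * (J + 1 + M) - 0).factorial = f' at *
  push_cast at *
  field_simp
  ring

theorem Cp_rec (lam : ℂ) (a J M : ℕ) (m : ℤ) (r : ℕ) (hr : r ≤ M) :
    Cp lam a (J + 1 + M) m (J + 1) r * (-(m : ℂ) * (lam + a - 1) +
        ((J : ℂ) + 1) * (lam - 1 + (a + m - 2 * (J + 1 + M) + J + 1 + 2 * r)))
      + (M : ℂ) * (2 * (J : ℂ) + M + 3) * Cp lam a (J + 1 + M) m (J + 2) r *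
        (a + m - 2 * (J + 1 + M) + J + 1 + r + (lam + (J + 1 + M) - 1))
      + (2 * ((J : ℂ) + 1) * Cp lam a (J + 1 + M) m (J + 1) (r + 1)
      + (M : ℂ) * (2 * (J : ℂ) + M + 3) * Cp lam a (J + 1 + M) m (J + 2) (r + 1)
      - Cp lam a (J + 1 + M) m J (r + 1)) = 0 := by
  unfold Cp
  have f0 : J + 1 + M - J = M + 1 := by omega
  have f1 : J + 1 + M - (J + 1) = M := by omega
  have f2 : J + 1 + M - (J + 2) = M - 1 := by omega
  rw [f0, f1, f2]
  rw [show J + 1 + M + (J + 2) = ((J + 1 + M + J) + 1) + 1 by ring,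
    show J + 1 + M + (J + 1) = (J + 1 + M + J) + 1 by ring, fact_c (J + 1 + M + J + 1), fact_c (J + 1 + M + J)]
  obtain ⟨d, rfl⟩ := Nat.exists_eq_add_of_le hr
  rw [show 2 * (J + 1 + (r + d)) - r = (2 * J + 1 + r + 2 * d) + 1 by omega,
    show 2 * (J + 1 + (r + d)) - (r + 1) = (2 * J + 1 + r + 2 * d) by omega, Nat.factorial_succ]
  simp only [Finset.prod_range_succ]
  -- binomial relations
  have b1 := choose_r (r + d) r (by omega)
  have b2 : ((r + d : ℕ) : ℂ) * ((r + d - 1).choose r : ℂ) = ((r + d).choose r : ℂ) * d := by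
    rcases Nat.eq_zero_or_pos (r + d) with h | h
    · have h1 : r = 0 := by omega
      have h2 : d = 0 := by omega
      subst h1 h2; simp
    · obtain ⟨q, hq⟩ : ∃ q, r + d = q + 1 := ⟨r + d - 1, by omega⟩
      have := choose_low q r (by omega)
      have hd : (d : ℂ) = q + 1 - r := by
        have : ((r + d : ℕ) : ℂ) = ((q + 1 : ℕ) : ℂ) := by rw [hq]
        push_cast at this; linear_combination this
      rw [hq, hd, Nat.add_sub_cancel]
      push_cast
      linear_combination -this
  have b3 : ((r + d : ℕ) : ℂ) * ((r + d - 1).choose (r + 1) : ℂ) * (r + 1)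
      = ((r + d).choose r : ℂ) * d * (d - 1) := by
    rcases Nat.eq_zero_or_pos d with h | h
    · subst h
      rw [Nat.choose_eq_zero_of_lt (by omega)]; simp
    · have := choose_r (r + d - 1) r (by omega)
      rw [mul_assoc, this, ← mul_assoc, b2, Nat.cast_sub (by omega)]
      push_cast; ring
  have b4 : ((r + d + 1).choose (r + 1) : ℂ) * (r + 1) = ((r + d).choose r : ℂ) * (r + d + 1) := by
    have := Nat.add_one_mul_choose_eq (r + d) r
    have h : ((r + d + 1 : ℕ) : ℂ) * ((r + d).choose r : ℂ) = ((r + d + 1).choose (r + 1) : ℂ) * ((r + 1 : ℕ) : ℂ) := by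
      exact_mod_cast this
    push_cast at h
    linear_combination -h
  have hr1 := cast_ne r
  have hf := fact_ne (J + 1 + (r + d) + J)
  have hg := cast_ne (J + 1 + (r + d) + J)
  have hg2 := cast_ne (J + 1 + (r + d) + J + 1)
  generalize (J + 1 + (r + d) + J).factorial = f at *
  generalize (2 * J + 1 + r + 2 * d).factorial = f' at *
  generalize (∏ i ∈ range r, (((J + 1 + (r + d) : ℕ) : ℂ) - (m : ℂ) - (i : ℂ))) = px at *
  generalize (∏ i ∈ range r, (lam + (a : ℂ) - ((J + 1 + (r + d) : ℕ) : ℂ) - 1 + (i : ℂ))) = py at *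
  generalize ((r + d).choose r : ℂ) = c0 at *
  generalize ((r + d).choose (r + 1) : ℂ) = c1 at *
  generalize ((r + d - 1).choose r : ℂ) = c2 at *
  generalize ((r + d - 1).choose (r + 1) : ℂ) = c3 at *
  generalize ((r + d + 1).choose (r + 1) : ℂ) = c4 at *
  push_cast at *
  have b1' : c1 * ((r : ℂ) + 1) = c0 * d := by linear_combination b1
  generalize hw : ((J : ℂ) + 1 + (r + d) + J + 1) = w at *
  have hw2 : (2 * (J : ℂ) + (r + d) + 3) = w + 1 := by rw [← hw]; ring
  rw [hw2]
  have k1 : ∀ x : ℂ, ((r : ℂ) + d) * (w + 1) * (c2 * (x / ((w + 1) * (w * f))) * px * py)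
      = c0 * d * (x / (w * f)) * px * py := by
    intro x
    field_simp
    linear_combination b2 * x * px * py
  have k2 : ∀ x y z : ℂ, ((r : ℂ) + d) * (w + 1) * (c3 * (x / ((w + 1) * (w * f))) * (px * y) * (py * z))
      = c0 * d * (d - 1) / (r + 1) * (x / (w * f)) * (px * y) * (py * z) := by
    intro x y z
    field_simp
    linear_combination b3 * x * px * py * y * z
  have hc1 : c1 = c0 * d / (r + 1) := by field_simp; linear_combination b1'
  have hc4 : c4 = c0 * (r + d + 1) / (r + 1) := by field_simp; linear_combination b4
  rw [k1, k2, hc1, hc4]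
  field_simp
  rw [← hw]
  ring
theorem id2 (lam : ℂ) (a J M : ℕ) (m : ℤ) (hM : 1 ≤ M) (γ0 γ1 : ℂ)
    (h0 : γ0 = gam (lam + ((J + 1 + M : ℕ) : ℂ) - 1) ((a : ℤ) + m - 2 * ((J + 1 + M : ℕ) : ℤ) + (J : ℤ)))
    (h1 : γ1 = gam (lam + ((J + 1 + M : ℕ) : ℂ) - 1) ((a : ℤ) + m - 2 * ((J + 1 + M : ℕ) : ℤ) + (J : ℤ) + 1)) :
    C (-Complex.I * γ0) * (C (2 * (-(m : ℂ)) * (lam + (a : ℂ) - 1)) * Fsum lam a (J + 1 + M) m (J + 1)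
      + C (2 * ((J : ℂ) + 1)) * (C (lam - 1) * Fsum lam a (J + 1 + M) m (J + 1)
        + X * derivative (Fsum lam a (J + 1 + M) m (J + 1))))
      - C ((M : ℂ) * (2 * (J : ℂ) + M + 3) * γ0 * γ1) * derivative (Fsum lam a (J + 1 + M) m (J + 2))
      + derivative (Fsum lam a (J + 1 + M) m J) = 0 := by
  set μ := lam + ((J + 1 + M : ℕ) : ℂ) - 1 with hμ
  set n := (a : ℤ) + m - 2 * ((J + 1 + M : ℕ) : ℤ) + (J : ℤ) + 1 with hn
  have hn0 : (a : ℤ) + m - 2 * ((J + 1 + M : ℕ) : ℤ) + (J : ℤ) = n - 1 := by rw [hn]; ring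
  rw [hn0] at h0
  set N := J + 1 + M with hN
  -- abbreviations
  let A : ℕ → ℂ[X] := fun r => gegenCit (μ - r) (n + 2 * r)
  let B : ℕ → ℂ[X] := fun r => gegenCit (μ - r + 1) (n + 2 * r)
  let Z : ℕ → ℂ[X] := fun r => gegenCit (μ - r + 1) (n + 2 * r - 2)
  have hZA : ∀ r, Z (r + 1) = A r := by
    intro r
    simp only [Z, A]
    congr 1 <;> push_cast <;> ring
  have hXA : ∀ r, X * derivative (A r) = C ((n : ℂ) + 2 * r) * A r + C 2 * Z r := by
    intro r
    have := gegen_euler (μ - r) (n + 2 * r)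
    push_cast at this
    exact this
  have hBA : ∀ r, C (γ1 * gam μ (n + 1)) * B r = C ((n : ℂ) + r + μ) * A r + Z r := by
    intro r
    have := gegen_three (μ - r) (n + 2 * r)
    rw [gam_shift, show n + 2 * (r : ℤ) + 1 = (n + 1) + 2 * r by ring, gam_shift, ← h1] at this
    push_cast at this
    rw [show (n : ℂ) + 2 * r + (μ - r) = n + r + μ by ring] at this
    exact this
  have hFj : Fsum lam a N m (J + 1) = ∑ r ∈ range (M + 1), C (Cp lam a N m (J + 1) r) * A r := by
    unfold Fsum
    rw [show N - (J + 1) + 1 = M + 1 by omega]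
    refine Finset.sum_congr rfl fun r _ => ?_
    simp only [A]
    rw [show (a : ℤ) + m - 2 * (N : ℤ) + ((J + 1 : ℕ) : ℤ) + 2 * r = n + 2 * r by rw [hn]; push_cast; ring]
  have hFj1 : derivative (Fsum lam a N m (J + 2))
      = ∑ r ∈ range (M + 1), C (Cp lam a N m (J + 2) r * (2 * Complex.I * gam μ (n + 1))) * B r := by
    rw [Finset.sum_range_succ, Cp_vanish lam a N m (J + 2) M (by omega)]
    unfold Fsum
    rw [show N - (J + 2) + 1 = M by omega, derivative_sum]
    simp only [zero_mul, C_0, add_zero]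
    refine Finset.sum_congr rfl fun r _ => ?_
    simp only [B]
    rw [show (a : ℤ) + m - 2 * (N : ℤ) + ((J + 2 : ℕ) : ℤ) + 2 * r = (n + 1) + 2 * r by
      rw [hn]; push_cast; ring, derivative_C_mul, gegen_deriv, gam_shift,
      show n + 1 + 2 * (r : ℤ) - 1 = n + 2 * r by ring, ← mul_assoc, ← C_mul, ← hμ]
  have hFJ : derivative (Fsum lam a N m J)
      = ∑ r ∈ range (M + 2), C (Cp lam a N m J r * (2 * Complex.I * γ0)) * Z r := by
    unfold Fsum
    rw [show N - J + 1 = M + 2 by omega, derivative_sum]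
    refine Finset.sum_congr rfl fun r _ => ?_
    simp only [Z]
    rw [show (a : ℤ) + m - 2 * (N : ℤ) + (J : ℤ) + 2 * r = (n - 1) + 2 * r by
      rw [hn]; push_cast; ring, derivative_C_mul, gegen_deriv, gam_shift, h0,
      show n - 1 + 2 * (r : ℤ) - 1 = n + 2 * r - 2 by ring, ← mul_assoc, ← C_mul, ← hμ]
  let al : ℕ → ℂ := fun r => Cp lam a N m (J + 1) r * (-(m : ℂ) * (lam + a - 1) +
        ((J : ℂ) + 1) * (lam - 1 + (n + 2 * r)))
      + (M : ℂ) * (2 * (J : ℂ) + M + 3) * Cp lam a N m (J + 2) r * (n + r + μ)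
  let be : ℕ → ℂ := fun r => 2 * ((J : ℂ) + 1) * Cp lam a N m (J + 1) r
      + (M : ℂ) * (2 * (J : ℂ) + M + 3) * Cp lam a N m (J + 2) r
      - Cp lam a N m J r
  have hal : ∀ r ≤ M, al r + be (r + 1) = 0 := by
    intro r hr
    have := Cp_rec lam a J M m r hr
    simp only [al, be]
    rw [hn, hμ]
    push_cast at this ⊢
    have hNc : (N : ℂ) = J + 1 + M := by rw [hN]; push_cast; ring
    rw [← hN] at this
    rw [hNc]
    linear_combination this
  have hbe0 : be 0 = 0 := Cp_zero lam a J M m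
  have hcore : ∑ r ∈ range (M + 1), C (al r) * A r + ∑ r ∈ range (M + 2), C (be r) * Z r = 0 := by
    rw [Finset.sum_range_succ' (fun r => C (be r) * Z r), hbe0, C_0, zero_mul, add_zero,
      ← Finset.sum_add_distrib]
    refine Finset.sum_eq_zero fun r hr => ?_
    rw [hZA, ← add_mul, ← C_add, hal r (by have := Finset.mem_range.1 hr; omega), C_0, zero_mul]
  have hsplit : ∑ r ∈ range (M + 2), C (be r) * Z r
      = ∑ r ∈ range (M + 1), C (be r + Cp lam a N m J r) * Z r
        - ∑ r ∈ range (M + 2), C (Cp lam a N m J r) * Z r := by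
    rw [Finset.sum_range_succ _ (M + 1), Finset.sum_range_succ _ (M + 1)]
    have hv : be (M + 1) = - Cp lam a N m J (M + 1) := by
      simp only [be]
      rw [Cp_vanish lam a N m (J + 1) (M + 1) (by omega),
        Cp_vanish lam a N m (J + 2) (M + 1) (by omega)]
      ring
    rw [hv, ← sub_sub, ← Finset.sum_sub_distrib]
    simp only [C_add, C_neg]
    rw [neg_mul, ← sub_eq_add_neg]
    congr 1
    refine Finset.sum_congr rfl fun r _ => ?_
    ring
  have hZs : ∑ r ∈ range (M + 2), C (Cp lam a N m J r * (2 * Complex.I * γ0)) * Z r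
      = C (2 * Complex.I * γ0) * ∑ r ∈ range (M + 2), C (Cp lam a N m J r) * Z r := by
    rw [Finset.mul_sum]
    refine Finset.sum_congr rfl fun r _ => ?_
    rw [C_mul]; ring
  have hmain : C (-Complex.I * γ0) * (C (2 * (-(m : ℂ)) * (lam + (a : ℂ) - 1)) * Fsum lam a N m (J + 1)
      + C (2 * ((J : ℂ) + 1)) * (C (lam - 1) * Fsum lam a N m (J + 1)
        + X * derivative (Fsum lam a N m (J + 1))))
      - C ((M : ℂ) * (2 * (J : ℂ) + M + 3) * γ0 * γ1) * derivative (Fsum lam a N m (J + 2))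
      = C (-2 * Complex.I * γ0) * (∑ r ∈ range (M + 1), C (al r) * A r +
        ∑ r ∈ range (M + 1), C (be r + Cp lam a N m J r) * Z r) := by
    rw [hFj, hFj1, derivative_sum]
    simp only [Finset.mul_sum, ← Finset.sum_add_distrib, ← Finset.sum_sub_distrib]
    refine Finset.sum_congr rfl fun r _ => ?_
    have e1 := hXA r
    have e2 := hBA r
    have h2C : (C (2 : ℂ) : ℂ[X]) = 2 := rfl
    have h3C : (C (3 : ℂ) : ℂ[X]) = 3 := rfl
    simp only [derivative_C_mul, al, be]
    simp only [C_mul, C_add, C_sub, C_neg, h2C, h3C, C_1] at *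
    linear_combination (-2 * C Complex.I * C γ0 * (C (J : ℂ) + 1) * C (Cp lam a N m (J + 1) r)) * e1
      - 2 * C Complex.I * C γ0 * C (M : ℂ) * (2 * C (J : ℂ) + C (M : ℂ) + 3) * C (Cp lam a N m (J + 2) r) * e2
  rw [hmain, hFJ, hZs]
  rw [hsplit] at hcore
  have hc2 : (C (-2 * Complex.I * γ0) : ℂ[X]) = - C (2 * Complex.I * γ0) := by
    rw [← C_neg]; congr 1; ring
  rw [hc2]
  linear_combination (-C (2 * Complex.I * γ0)) * hcore

theorem Gam_succ (lam : ℂ) (a N : ℕ) (m : ℤ) (j : ℕ) (h : j + 1 ≤ N) :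
    GammaP lam a N m j = GammaP lam a N m (j + 1) *
      gam (lam + (N : ℂ) - 1) ((a : ℤ) + m - 2 * (N : ℤ) + j) := by
  unfold GammaP
  rw [show N - j = N - (j + 1) + 1 by omega, Finset.prod_range_succ]
  congr 2
  push_cast [Nat.cast_sub h]
  ring

/-- The scalar in front of `f_j` in `(E_j^+)`. -/
def Kc (lam : ℂ) (a N : ℕ) (m : ℤ) (j : ℕ) : ℂ :=
  (-Complex.I) ^ (N - j) * (((2 * N).factorial : ℂ) / ((N + j).factorial : ℂ)) *
      GammaP lam a N m j

theorem Kc_succ (lam : ℂ) (a N : ℕ) (m : ℤ) (j : ℕ) (h : j + 1 ≤ N) :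
    Kc lam a N m j = Kc lam a N m (j + 1) * (-Complex.I * ((N : ℂ) + j + 1) *
      gam (lam + (N : ℂ) - 1) ((a : ℤ) + m - 2 * (N : ℤ) + j)) := by
  unfold Kc
  rw [Gam_succ lam a N m j h, show N - j = N - (j + 1) + 1 by omega, pow_succ,
    show N + (j + 1) = (N + j) + 1 by ring, fact_c]
  have h1 := fact_ne (N + j)
  have h2 := cast_ne (N + j)
  push_cast at *
  field_simp

theorem Fsum_coeff_zero (lam : ℂ) (a N : ℕ) (m : ℤ) (j : ℕ) (h : ¬ (2 : ℤ) ∣ ((a : ℤ) + m + j)) :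
    (Fsum lam a N m j).coeff 0 = 0 := by
  unfold Fsum
  rw [finsetSum_coeff]
  refine Finset.sum_eq_zero fun r _ => ?_
  rw [coeff_C_mul, coefB, mul_zero]
  intro k hk
  apply h
  push_cast at hk
  omega

/-- recursion step on the `+` side (Lemma 4.7(1)). -/
theorem stmt6 (lam : ℂ) (a N : ℕ) (m : ℤ) (hm : (N : ℤ) < m) (ha : m - (N : ℤ) ≤ (a : ℤ))
    (qp : ℂ) (j : ℕ) (hj1 : 1 ≤ j) (hj2 : (j : ℤ) ≤ (N : ℤ) - 1)
    (fjm1 fj fj1 : ℂ[X])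
    (hfj : Eplus lam a N m qp j fj) (hfj1 : Eplus lam a N m qp (j + 1) fj1)
    (hG : GammaP lam a N m (j - 1) ≠ 0)
    (hpol : polEven ((a : ℤ) - m + (j : ℤ) - 1) fjm1) :
    (gegenS (lam + (j : ℂ) - 2) ((a : ℤ) + m - (j : ℤ) + 1) fjm1
        - C (2 * ((N : ℂ) - (j : ℂ) + 1)) * derivative fj = 0 ∧
      C (2 * (-(m : ℂ)) * (lam + (a : ℂ) - 1)) * fj
        + C (2 * (j : ℂ)) * (C (lam - 1) * fj + euler fj)
        + C ((N : ℂ) - (j : ℂ)) * derivative fj1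
        + C ((N : ℂ) + (j : ℂ)) * derivative fjm1 = 0)
    ↔ Eplus lam a N m qp (j - 1) fjm1 := by
  obtain ⟨J, rfl⟩ : ∃ J, j = J + 1 := ⟨j - 1, by omega⟩
  obtain ⟨M, rfl⟩ : ∃ M, N = J + 1 + M := ⟨N - (J + 1), by omega⟩
  have hM : 1 ≤ M := by push_cast at hj2; omega
  rw [Nat.add_sub_cancel] at *
  have i1 := id1 lam a J M m
  have i2 := id2 lam a J M m hM _ _ rfl rfl
  have k0 := Kc_succ lam a (J + 1 + M) m J (by omega)
  have k1 := Kc_succ lam a (J + 1 + M) m (J + 1) (by omega)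
  set N := J + 1 + M with hN
  have hg0 : gam (lam + (N : ℂ) - 1) ((a : ℤ) + m - 2 * (N : ℤ) + J) ≠ 0 := by
    rw [Gam_succ lam a N m J (by omega)] at hG
    exact right_ne_zero_of_mul hG
  have hK : Kc lam a N m J ≠ 0 := by
    unfold Kc
    refine mul_ne_zero (mul_ne_zero (pow_ne_zero _ (neg_ne_zero.2 Complex.I_ne_zero)) ?_) hG
    exact div_ne_zero (fact_ne _) (fact_ne _)
  have hK1 : Kc lam a N m (J + 1) ≠ 0 := by
    rw [k0] at hK; exact left_ne_zero_of_mul hK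
  have hK2 : Kc lam a N m (J + 2) ≠ 0 := by
    rw [k1] at hK1; exact left_ne_zero_of_mul hK1
  have hfj' : C (Kc lam a N m (J + 1)) * fj = C qp * Fsum lam a N m (J + 1) := hfj
  have hfj1' : C (Kc lam a N m (J + 2)) * fj1 = C qp * Fsum lam a N m (J + 2) := hfj1
  have hE : Eplus lam a N m qp J fjm1 ↔ C (Kc lam a N m J) * fjm1 = C qp * Fsum lam a N m J := Iff.rfl
  rw [hE]
  have hdj : C (Kc lam a N m (J + 1)) * derivative fj = C qp * derivative (Fsum lam a N m (J + 1)) := by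
    rw [← derivative_C_mul, hfj', derivative_C_mul]
  have hdj1 : C (Kc lam a N m (J + 2)) * derivative fj1 = C qp * derivative (Fsum lam a N m (J + 2)) := by
    rw [← derivative_C_mul, hfj1', derivative_C_mul]
  have a1 : lam + ((J + 1 : ℕ) : ℂ) - 2 = lam + (J : ℂ) - 1 := by push_cast; ring
  have a2 : (a : ℤ) + m - ((J + 1 : ℕ) : ℤ) + 1 = (a : ℤ) + m - J := by push_cast; ring
  have a3 : (a : ℤ) + m - 2 * (N : ℤ) + ((J + 1 : ℕ) : ℤ) = (a : ℤ) + m - 2 * (N : ℤ) + J + 1 := by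
    push_cast; ring
  have a4 : (N : ℂ) = (J : ℂ) + 1 + M := by rw [hN]; push_cast; ring
  rw [a1, a2]
  rw [a3] at k1
  generalize hγ0 : gam (lam + (N : ℂ) - 1) ((a : ℤ) + m - 2 * (N : ℤ) + J) = γ0 at *
  generalize gam (lam + (N : ℂ) - 1) ((a : ℤ) + m - 2 * (N : ℤ) + J + 1) = γ1 at *
  rw [show J + 1 + 1 = J + 2 from rfl] at k1
  -- the two equations, multiplied by the scalar `Kc J`, applied to a polynomial `g`
  have hCK : (C (Kc lam a N m J) : ℂ[X]) ≠ 0 := by rwa [Ne, C_eq_zero]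
  have eq1 : C (Kc lam a N m J) * (C (2 * ((N : ℂ) - ((J + 1 : ℕ) : ℂ) + 1)) * derivative fj)
      = gegenS (lam + (J : ℂ) - 1) ((a : ℤ) + m - J) (C qp * Fsum lam a N m J) := by
    rw [gegenS_C_mul, i1, k0]
    rw [a4]
    push_cast
    simp only [C_mul, C_add, C_sub, C_neg, C_1] at *
    linear_combination (C (2 : ℂ) * (C (M : ℂ) + 1)) * (-C Complex.I) * (C (J : ℂ) + 1 + C (M : ℂ) + C (J : ℂ) + 1) * C γ0 * hdj
  have eq2 : C (Kc lam a N m J) * (C (2 * (-(m : ℂ)) * (lam + (a : ℂ) - 1)) * fj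
        + C (2 * ((J + 1 : ℕ) : ℂ)) * (C (lam - 1) * fj + euler fj)
        + C ((N : ℂ) - ((J + 1 : ℕ) : ℂ)) * derivative fj1)
      = - (C ((N : ℂ) + ((J + 1 : ℕ) : ℂ)) * (C qp * derivative (Fsum lam a N m J))) := by
    have hII : (C Complex.I : ℂ[X]) * C Complex.I = -1 := by
      rw [← C_mul, Complex.I_mul_I]; simp
    have k01 : (C (Kc lam a N m J) : ℂ[X]) = - (C (Kc lam a N m (J + 2)) * C (((N : ℂ) + J + 1) * ((N : ℂ) + J + 2) * γ0 * γ1)) := by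
      rw [← C_mul, ← C_neg, k0, k1]
      congr 1
      push_cast
      linear_combination (Kc lam a N m (J + 2) * (((N : ℂ) + J + 1) * ((N : ℂ) + J + 2) * γ0 * γ1)) * Complex.I_mul_I
    rw [mul_add]
    nth_rw 2 [k01]
    rw [k0]
    unfold euler
    rw [a4] at *
    push_cast at *
    have h2C : (C (2 : ℂ) : ℂ[X]) = 2 := rfl
    have h3C : (C (3 : ℂ) : ℂ[X]) = 3 := rfl
    simp only [C_mul, C_add, C_sub, C_neg, C_1, h2C, h3C] at hfj' hdj hdj1 i2 ⊢
    set P : ℂ[X] := C (J : ℂ) + 1 + C (M : ℂ) + C (J : ℂ) + 1 with hP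
    linear_combination (-C Complex.I * P * C γ0 * (2 * (-C (m : ℂ)) * (C lam + C (a : ℂ) - 1) + 2 * (C (J : ℂ) + 1) * (C lam - 1))) * hfj'
      + (-C Complex.I * P * C γ0 * 2 * (C (J : ℂ) + 1) * X) * hdj
      - (P * (P + 1) * C γ0 * C γ1 * C (M : ℂ)) * hdj1 + C qp * P * i2
  constructor
  · rintro ⟨h1, h2⟩
    have d2 : C ((N : ℂ) + ((J + 1 : ℕ) : ℂ)) * derivative (C (Kc lam a N m J) * fjm1 - C qp * Fsum lam a N m J) = 0 := by
      rw [derivative_sub, derivative_C_mul, derivative_C_mul]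
      linear_combination C (Kc lam a N m J) * h2 - eq2
    have hne : (C ((N : ℂ) + ((J + 1 : ℕ) : ℂ)) : ℂ[X]) ≠ 0 := by
      rw [Ne, C_eq_zero]
      have := cast_ne (N + J)
      push_cast at this ⊢
      rwa [← add_assoc]
    have d3 := (mul_eq_zero.1 d2).resolve_left hne
    have d4 := eq_C_of_derivative_eq_zero d3
    have d1 : gegenS (lam + (J : ℂ) - 1) ((a : ℤ) + m - J) (C (Kc lam a N m J) * fjm1 - C qp * Fsum lam a N m J) = 0 := by
      rw [sub_eq_add_neg (C (Kc lam a N m J) * fjm1), gegenS_add, gegenS_C_mul]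
      have : -(C qp * Fsum lam a N m J) = C (-1) * (C qp * Fsum lam a N m J) := by simp
      rw [this, gegenS_C_mul, ← eq1]
      simp only [C_neg, C_1]
      linear_combination C (Kc lam a N m J) * h1
    set c := (C (Kc lam a N m J) * fjm1 - C qp * Fsum lam a N m J).coeff 0 with hc
    suffices c = 0 by
      rw [this, C_0] at d4
      exact sub_eq_zero.1 d4
    by_cases hpar : (2 : ℤ) ∣ ((a : ℤ) + m + J)
    · rw [d4, gegenS] at d1
      simp only [derivative_C, mul_zero, derivative_zero, zero_add, zero_sub, neg_neg, ← C_mul,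
        C_eq_zero] at d1
      refine (mul_eq_zero.1 d1).resolve_left (mul_ne_zero ?_ ?_)
      · rw [Int.cast_ne_zero]
        push_cast at *; omega
      · intro h
        apply hg0
        rw [← hγ0, gam, if_pos (by omega)]
        obtain ⟨q, hq⟩ := hpar
        have e : ((a : ℤ) + m - 2 * (N : ℤ) + J) / 2 = q - N := by omega
        have hqc : (a : ℂ) + m + J = 2 * q := by exact_mod_cast hq
        rw [e]
        push_cast at h ⊢
        linear_combination h / 2 - hqc / 2
    · rw [hc, coeff_sub, coeff_C_mul, coeff_C_mul, Fsum_coeff_zero lam a N m J hpar]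
      have : fjm1.coeff 0 = 0 := by
        by_contra h
        have := (hpol 0 h).2
        apply hpar
        push_cast at this
        omega
      rw [this]; ring
  · intro h
    constructor
    · apply mul_left_cancel₀ hCK
      rw [mul_sub, eq1, ← gegenS_C_mul, h]
      simp
    · apply mul_left_cancel₀ hCK
      rw [mul_add, eq2, ← derivative_C_mul, ← h, derivative_C_mul]
      ring
end
end

section
/- Let N ∈ ℕ, m ∈ ℤ with m > N, a ∈ ℕ with a ≥ m−N, q ∈ ℤ with max(0, N-a+m) ≤ q ≤ 2N, set λ := N+1-a-q, and let j be an integer with 0 ≤ j ≤ N and a+j ≥ m. Then, as polynomials in t, (Γ(λ+⌊(a+m+j-1)/2⌋)/Γ(λ+⌊(a-m-1)/2⌋)) Σ_{r=0}^{N-j} C_{j,r}^+ C̃_{a+m-2N+j+2r}^{λ+N-1-r}(it) = (Γ(λ+⌊(a-m+j-1)/2⌋+q-N)/Γ(λ+⌊(a-m-1)/2⌋)) Σ_{r=0}^{N-j} D_{j,r} C̃_{a-m+j+2(q-2N+r)}^{λ+N-1-r}(it). -/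
noncomputable section

open Polynomial Finset

/-- Rising factorial. -/
def rf (x : ℂ) (n : ℕ) : ℂ := ∏ i ∈ range n, (x + (i : ℂ))

theorem rf_zero (x : ℂ) : rf x 0 = 1 := by simp [rf]

theorem rf_succ (x : ℂ) (n : ℕ) : rf x (n + 1) = rf x n * (x + n) := by
  simp [rf, prod_range_succ]

theorem rf_succ' (x : ℂ) (n : ℕ) : rf x (n + 1) = x * rf (x + 1) n := by
  unfold rf
  rw [prod_range_succ', mul_comm]
  congr 1
  · simp
  · apply prod_congr rfl
    intro i _
    push_cast
    ring

theorem rf_add (x : ℂ) (m n : ℕ) : rf x (m + n) = rf x m * rf (x + m) n := by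
  unfold rf
  rw [prod_range_add]
  congr 1
  apply prod_congr rfl
  intro i _
  push_cast
  ring

/-- Chu-Vandermonde. -/
theorem vander (n : ℕ) : ∀ x e : ℂ,
    ∑ s ∈ range (n + 1), (-1 : ℂ) ^ s * (n.choose s : ℂ) * rf x s * rf (e + s) (n - s)
      = rf (e - x) n := by
  induction n with
  | zero => intro x e; simp [rf_zero]
  | succ n ih =>
    intro x e
    rw [sum_range_succ']
    have h1 : ∀ s ∈ range (n + 1),
        (-1 : ℂ) ^ (s + 1) * ((n + 1).choose (s + 1) : ℂ) * rf x (s + 1)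
            * rf (e + (s + 1 : ℕ)) (n + 1 - (s + 1))
          = -x * ((-1 : ℂ) ^ s * (n.choose s : ℂ) * rf (x + 1) s * rf (e + 1 + s) (n - s))
            + (-1 : ℂ) ^ (s + 1) * (n.choose (s + 1) : ℂ) * rf x (s + 1)
              * rf (e + (s + 1 : ℕ)) (n + 1 - (s + 1)) := by
      intro s _
      have : e + ((s + 1 : ℕ) : ℂ) = e + 1 + s := by push_cast; ring
      rw [this, Nat.add_sub_add_right, Nat.choose_succ_succ, rf_succ']
      push_cast
      ring
    rw [sum_congr rfl h1, sum_add_distrib, ← mul_sum, ih, add_assoc]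
    have h2 : ∑ s ∈ range (n + 1), (-1 : ℂ) ^ (s + 1) * (n.choose (s + 1) : ℂ) * rf x (s + 1)
              * rf (e + (s + 1 : ℕ)) (n + 1 - (s + 1))
          + (-1 : ℂ) ^ 0 * ((n + 1).choose 0 : ℂ) * rf x 0 * rf (e + (0 : ℕ)) (n + 1 - 0)
        = (e + n) * rf (e - x) n := by
      rw [← ih x e, mul_sum]
      have h3 := sum_range_succ' (fun s => (-1 : ℂ) ^ s * (n.choose s : ℂ) * rf x s
              * rf (e + s) (n + 1 - s)) (n + 1)
      have h4 : (-1 : ℂ) ^ 0 * ((n + 1).choose 0 : ℂ) * rf x 0 * rf (e + (0 : ℕ)) (n + 1 - 0)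
        = (-1 : ℂ) ^ 0 * (n.choose 0 : ℂ) * rf x 0 * rf (e + (0 : ℕ)) (n + 1 - 0) := by simp
      rw [h4, ← h3, sum_range_succ]
      simp only [Nat.choose_succ_self, Nat.cast_zero, mul_zero, zero_mul, add_zero]
      apply sum_congr rfl
      intro s hs
      have hs' : s ≤ n := by simpa [Nat.lt_succ_iff] using hs
      rw [Nat.succ_sub hs', rf_succ]
      push_cast [Nat.cast_sub hs']
      ring
    rw [h2, rf_succ]
    have : e + 1 - (x + 1) = e - x := by ring
    rw [this]
    ring

/-- The terminating `3F2` sum, cleared of denominators. -/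
def TT (M : ℕ) (a b d e : ℂ) : ℂ :=
  ∑ r ∈ range (M + 1), (-1 : ℂ) ^ r * (M.choose r : ℂ) * rf (d + r) (M - r) * rf a r * rf b r
    * rf (e + r) (M - r)

def HH (M : ℕ) (a b d g : ℂ) : ℂ :=
  ∑ s ∈ range (M + 1), (M.choose s : ℂ) * rf (d + s) (M - s) * rf a s * rf b s * rf g (M - s)

theorem TT_eq_HH (M : ℕ) (a b d e : ℂ) : TT M a b d e = HH M (d - a) b d (e - b) := by
  unfold TT HH
  have h1 : ∀ r ∈ range (M + 1),
      (-1 : ℂ) ^ r * (M.choose r : ℂ) * rf (d + r) (M - r) * rf a r * rf b r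
        * rf (e + r) (M - r)
      = ∑ s ∈ range (r + 1), (-1 : ℂ) ^ (r + s) * (M.choose r * r.choose s : ℕ)
          * rf (d + s) (M - s) * rf (d - a) s * rf b r * rf (e + r) (M - r) := by
    intro r hr
    have hr' : r ≤ M := by simpa [Nat.lt_succ_iff] using hr
    have hv := vander r (d - a) d
    rw [sub_sub_cancel] at hv
    rw [← hv, mul_sum, sum_mul, sum_mul]
    apply sum_congr rfl
    intro s hs
    have hs' : s ≤ r := by simpa [Nat.lt_succ_iff] using hs
    have : M - s = (r - s) + (M - r) := by omega
    rw [this, rf_add, Nat.cast_sub hs']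
    have : d + s + ((r : ℂ) - s) = d + r := by ring
    rw [this]
    push_cast
    ring
  rw [sum_congr rfl h1]
  have h2 : ∀ s ∈ range (M + 1),
      (M.choose s : ℂ) * rf (d + s) (M - s) * rf (d - a) s * rf b s * rf (e - b) (M - s)
      = ∑ r ∈ Finset.Ico s (M + 1), (-1 : ℂ) ^ (r + s) * (M.choose r * r.choose s : ℕ)
          * rf (d + s) (M - s) * rf (d - a) s * rf b r * rf (e + r) (M - r) := by
    intro s hs
    have hs' : s ≤ M := by simpa [Nat.lt_succ_iff] using hs
    have hv := vander (M - s) (b + s) (e + s)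
    rw [add_sub_add_right_eq_sub] at hv
    rw [← hv, mul_sum, sum_Ico_eq_sum_range, Nat.succ_sub hs']
    apply sum_congr rfl
    intro t ht
    have ht' : t ≤ M - s := by simpa [Nat.lt_succ_iff] using ht
    rw [Nat.choose_mul (by omega), rf_add b s t]
    have e1 : (-1 : ℂ) ^ (s + t + s) = (-1) ^ t := by
      rw [show s + t + s = 2 * s + t by ring, pow_add, pow_mul]; simp
    have e2 : M - (s + t) = M - s - t := by omega
    have e3 : s + t - s = t := by omega
    have e4 : e + ((s + t : ℕ) : ℂ) = e + s + t := by push_cast; ring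
    rw [e1, e2, e3, e4]
    push_cast
    ring
  rw [sum_congr rfl h2]
  apply Finset.sum_comm'
  intro r s
  simp only [Finset.mem_range, Finset.mem_Ico]
  omega

theorem HH_symm (M : ℕ) (a b d g : ℂ) : HH M a b d g = HH M b a d g := by
  unfold HH
  apply sum_congr rfl
  intro s _
  ring

theorem TT_symm (M : ℕ) (a b d e : ℂ) : TT M a b d e = TT M b a d e := by
  unfold TT
  apply sum_congr rfl
  intro s _
  ring

theorem TT_transf (M : ℕ) (a b d e : ℂ) :
    TT M a b d e = TT M (d - a) (d - b) d (d + e - a - b) := by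
  rw [TT_symm M (d - a), TT_eq_HH, TT_eq_HH, HH_symm]
  congr 1 <;> ring

/-! Coefficients of the Gegenbauer polynomials. -/

theorem coeff_gegenC (μ : ℂ) (n p : ℕ) :
    (gegenC μ n).coeff p = ∑ k ∈ range (n / 2 + 1), if p = n - 2 * k then
      ((-1 : ℂ) ^ k / ((k.factorial : ℂ) * ((n - 2 * k).factorial : ℂ)) *
        ∏ s ∈ range (n / 2 - k), (μ + (((n + 1) / 2 : ℕ) : ℂ) + (s : ℂ))) * 2 ^ p else 0 := by
  unfold gegenC
  rw [finsetSum_coeff]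
  apply sum_congr rfl
  intro k _
  rw [coeff_C_mul, mul_pow, ← C_pow, coeff_C_mul, coeff_X_pow]
  split_ifs with h
  · rw [h]; ring
  · simp

theorem coeff_git_zero (μ : ℂ) (ℓ : ℤ) (p : ℕ) (h : ¬ ∃ k : ℕ, ℓ = p + 2 * k) :
    (gegenCit μ ℓ).coeff p = 0 := by
  unfold gegenCit gegenCZ
  rw [comp_C_mul_X_coeff]
  split_ifs with h0
  · rw [coeff_gegenC, sum_eq_zero, zero_mul]
    intro k hk
    have hk' := Finset.mem_range.mp hk
    rw [if_neg]
    intro hp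
    exact h ⟨k, by omega⟩
  · simp

theorem coeff_git (μ : ℂ) (p k : ℕ) :
    (gegenCit μ (p + 2 * k)).coeff p =
      (-1 : ℂ) ^ k / (k.factorial : ℂ) * (Complex.I ^ p * 2 ^ p / (p.factorial : ℂ))
        * rf (μ + k + ((p + 1) / 2 : ℕ)) (p / 2) := by
  unfold gegenCit gegenCZ
  rw [comp_C_mul_X_coeff, if_pos (by omega), coeff_gegenC]
  have : ((p : ℤ) + 2 * k).toNat = p + 2 * k := by omega
  rw [this, sum_eq_single k]
  · rw [if_pos (by omega)]
    have e1 : p + 2 * k - 2 * k = p := by omega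
    have e2 : (p + 2 * k) / 2 - k = p / 2 := by omega
    have e3 : (p + 2 * k + 1) / 2 = k + (p + 1) / 2 := by omega
    rw [e1, e2, e3]
    unfold rf
    have : ∀ s ∈ range (p / 2), (μ + ((k + (p + 1) / 2 : ℕ) : ℂ) + (s : ℂ))
       = μ + k + ((p + 1) / 2 : ℕ) + s := by
      intro s _; rw [Nat.cast_add]; ring
    rw [prod_congr rfl this, div_mul_eq_div_div]
    ring
  · intro b hb hne
    have := Finset.mem_range.mp hb
    rw [if_neg (by omega)]
  · intro hb
    exfalso; apply hb
    rw [Finset.mem_range]; omega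

theorem fact_rf (n k : ℕ) : ((n + k).factorial : ℂ) = n.factorial * rf (n + 1) k := by
  induction k with
  | zero => simp [rf_zero]
  | succ k ih =>
    rw [← add_assoc, Nat.factorial_succ, rf_succ, ← mul_assoc, ← ih]
    push_cast
    ring

theorem rf_zero_of (x : ℂ) (n i : ℕ) (hi : i < n) (h : x + i = 0) : rf x n = 0 :=
  Finset.prod_eq_zero (Finset.mem_range.mpr hi) h

theorem rf_neg (x : ℂ) (n : ℕ) : rf x n = (-1) ^ n * rf (-x - n + 1) n := by
  unfold rf
  rw [← prod_range_reflect, show ((-1 : ℂ)) ^ n = ∏ i ∈ range n, (-1 : ℂ) by simp,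
    ← prod_mul_distrib]
  apply prod_congr rfl
  intro i hi
  have := Finset.mem_range.mp hi
  rw [show n - 1 - i = n - (1 + i) by omega, Nat.cast_sub (by omega)]
  push_cast
  ring

/-- The general coefficient sum. -/
theorem sum_coeff_zero (M : ℕ) (c : ℕ → ℂ) (μ : ℕ → ℂ) (l0 : ℤ) (p : ℕ)
    (h : ¬ ∃ U : ℕ, l0 + 2 * M = p + 2 * U) :
    (∑ r ∈ range (M + 1), C (c r) * gegenCit (μ r) (l0 + 2 * (r : ℤ))).coeff p = 0 := by
  rw [finsetSum_coeff, sum_eq_zero]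
  intro r hr
  have := Finset.mem_range.mp hr
  rw [coeff_C_mul, coeff_git_zero, mul_zero]
  rintro ⟨k, hk⟩
  exact h ⟨k + (M - r), by omega⟩

theorem sum_coeff (N j : ℕ) (hj : j ≤ N) (α β μ : ℂ) (l0 : ℤ) (p U : ℕ)
    (h : l0 + 2 * ((N - j : ℕ) : ℤ) = p + 2 * U) :
    (∑ r ∈ range (N - j + 1), C (((N - j).choose r : ℂ) *
        (((2 * N - r).factorial : ℂ) / ((N + j).factorial : ℂ)) *
        (∏ i ∈ range r, (α - (i : ℂ))) * (∏ i ∈ range r, (β + (i : ℂ))))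
        * gegenCit (μ - r) (l0 + 2 * (r : ℤ))).coeff p
      = (Complex.I ^ p * 2 ^ p / (p.factorial : ℂ)) * ((-1) ^ U / (U.factorial : ℂ))
        * rf (μ + U - (N - j : ℕ) + ((p + 1) / 2 : ℕ)) (p / 2)
        * TT (N - j) (-α) β (-(2 * N)) (U - (N - j : ℕ) + 1) := by
  obtain ⟨M, rfl⟩ : ∃ M, N = j + M := ⟨N - j, by omega⟩
  have hM : j + M - j = M := by omega
  rw [hM] at h ⊢
  rw [finsetSum_coeff, TT, mul_sum]
  apply sum_congr rfl
  intro r hr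
  have hr' := Finset.mem_range.mp hr
  obtain ⟨t, rfl⟩ : ∃ t, M = r + t := ⟨M - r, by omega⟩
  have ht : r + t - r = t := by omega
  rw [coeff_C_mul, ht]
  have f1 : ∏ i ∈ range r, (α - (i : ℂ)) = (-1) ^ r * rf (-α) r := by
    unfold rf
    rw [show ((-1 : ℂ)) ^ r = ∏ i ∈ range r, (-1 : ℂ) by simp, ← prod_mul_distrib]
    apply prod_congr rfl
    intro i _
    ring
  have f2 : ((2 * (j + (r + t)) - r).factorial : ℂ) / ((j + (r + t) + j).factorial : ℂ)
      = (-1) ^ t * rf (-(2 * ((j + (r + t) : ℕ) : ℂ)) + r) t := by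
    rw [show 2 * (j + (r + t)) - r = (j + (r + t) + j) + t by omega, fact_rf,
      rf_neg (-(2 * ((j + (r + t) : ℕ) : ℂ)) + r) t,
      mul_div_cancel_left₀ _ (by exact_mod_cast Nat.factorial_ne_zero _), ← mul_assoc,
      ← mul_pow]
    simp only [mul_neg, neg_mul, one_mul, neg_neg, one_pow]
    congr 1
    push_cast
    ring
  rw [f1, f2]
  by_cases hU : t ≤ U
  · obtain ⟨k, rfl⟩ : ∃ k, U = k + t := ⟨U - t, by omega⟩
    have hl : l0 + 2 * (r : ℤ) = p + 2 * k := by push_cast at h; omega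
    rw [hl, coeff_git]
    have a1 : μ - r + k + ((p + 1) / 2 : ℕ)
      = μ + (k + t : ℕ) - (r + t : ℕ) + ((p + 1) / 2 : ℕ) := by push_cast; ring
    have a2 : (((k + t : ℕ) : ℂ) - ((r + t : ℕ) : ℂ) + 1 + r) = k + 1 := by push_cast; ring
    have hk : (k.factorial : ℂ) ≠ 0 := by exact_mod_cast Nat.factorial_ne_zero _
    have hkt : ((k + t).factorial : ℂ) ≠ 0 := by exact_mod_cast Nat.factorial_ne_zero _
    have a3 : 1 / (k.factorial : ℂ) = rf (k + 1) t / ((k + t).factorial : ℂ) := by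
      rw [div_eq_div_iff hk hkt, fact_rf]; ring
    rw [a1, a2, div_eq_mul_one_div _ (k.factorial : ℂ), a3, pow_add (-1 : ℂ) k t]
    change _ * rf β r * _ = _
    ring
  · rw [coeff_git_zero, mul_zero]
    · rw [rf_zero_of (((U : ℕ) : ℂ) - ((r + t : ℕ) : ℂ) + 1 + r) t (t - U - 1) (by omega)]
      · ring
      · rw [show t - U - 1 = t - (U + 1) by omega, Nat.cast_sub (by omega)]
        push_cast
        ring
    · rintro ⟨k, hk⟩
      push_cast at h
      omega

/-! Gamma ratios. -/

theorem rf_negnat (u n : ℕ) :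
    rf (-((u + n : ℕ) : ℂ)) n = (-1) ^ n * ((u + n).factorial : ℂ) / (u.factorial : ℂ) := by
  have hu : (u.factorial : ℂ) ≠ 0 := by exact_mod_cast Nat.factorial_ne_zero _
  rw [rf_neg, fact_rf, eq_div_iff hu]
  have : - -((u + n : ℕ) : ℂ) - n + 1 = u + 1 := by push_cast; ring
  rw [this]
  ring

theorem gratio_negnat (w u : ℕ) (k : ℤ) (hk : k = (w : ℤ) - u) :
    gratio (-(w : ℂ)) k = (-1) ^ (w + u) * (w.factorial : ℂ) / (u.factorial : ℂ) := by
  unfold gratio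
  split_ifs with h
  · obtain ⟨n, rfl⟩ : ∃ n, w = u + n := ⟨w - u, by omega⟩
    have : k.toNat = n := by omega
    rw [this]
    change rf _ _ = _
    rw [rf_negnat, show u + n + u = 2 * u + n by ring, pow_add, pow_mul]
    simp
  · obtain ⟨n, rfl⟩ : ∃ n, u = w + n := ⟨u - w, by omega⟩
    have : (-k).toNat = n := by omega
    rw [this]
    have : -(w : ℂ) + (k : ℂ) = -((w + n : ℕ) : ℂ) := by
      rw [hk]; push_cast; ring
    rw [this]
    change (rf _ _)⁻¹ = _
    rw [rf_negnat, show w + (w + n) = 2 * w + n by ring, pow_add, pow_mul, inv_div]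
    have hs : ((-1 : ℂ) ^ n) * (-1) ^ n = 1 := by rw [← mul_pow]; simp
    have h1 : ((w + n).factorial : ℂ) ≠ 0 := by exact_mod_cast Nat.factorial_ne_zero _
    have h2 : ((-1 : ℂ) ^ n) ≠ 0 := by simp
    rw [div_eq_div_iff (mul_ne_zero h2 h1) h1]
    simp only [even_two, Even.neg_pow, one_pow, one_mul]
    linear_combination (-(w.factorial : ℂ) * ((w + n).factorial : ℂ)) * hs

theorem gr_zero (x0 k : ℤ) (P : ℕ) (hx : x0 ≤ 0) (hk : 0 ≤ k) (h : 1 ≤ x0 + k + P) :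
    gratio (x0 : ℂ) k * rf ((x0 : ℂ) + k) P = 0 := by
  unfold gratio
  rw [if_pos hk]
  change rf _ _ * _ = 0
  obtain ⟨k, rfl⟩ := Int.eq_ofNat_of_zero_le hk
  have : ((k : ℤ) : ℂ) = (k : ℂ) := by simp
  rw [Int.toNat_natCast, this, ← rf_add]
  apply rf_zero_of _ _ (-x0).toNat (by omega)
  have : (((-x0).toNat : ℤ) : ℂ) = ((-x0 : ℤ) : ℂ) := by
    rw [Int.toNat_of_nonneg (by omega)]
  rw [Int.cast_natCast] at this
  rw [this]
  push_cast
  ring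

theorem gr_val (x0 k : ℤ) (P U : ℕ) (hx : x0 ≤ 0) (h : x0 + k + P = -U) :
    gratio (x0 : ℂ) k * rf ((x0 : ℂ) + k) P
      = (-1) ^ ((-x0).toNat + U) * ((-x0).toNat.factorial : ℂ) / (U.factorial : ℂ) := by
  obtain ⟨w, hw⟩ : ∃ w : ℕ, x0 = -w := ⟨(-x0).toNat, by omega⟩
  have e0 : (-x0).toNat = w := by omega
  have e1 : (x0 : ℂ) = -(w : ℂ) := by rw [hw]; push_cast; ring
  have e2 : (x0 : ℂ) + k = -((U + P : ℕ) : ℂ) := by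
    have : x0 + k = -((U + P : ℕ) : ℤ) := by push_cast; omega
    exact_mod_cast this
  rw [e2, e0, e1, gratio_negnat w (U + P) k (by push_cast; omega), rf_negnat]
  have h1 : ((U + P).factorial : ℂ) ≠ 0 := by exact_mod_cast Nat.factorial_ne_zero _
  have h2 : (U.factorial : ℂ) ≠ 0 := by exact_mod_cast Nat.factorial_ne_zero _
  have hs : ((-1 : ℂ) ^ P) * (-1) ^ P = 1 := by rw [← mul_pow]; simp
  rw [div_mul_div_comm, div_eq_div_iff (mul_ne_zero h1 h2) h2, ← add_assoc, pow_add _ _ P]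
  linear_combination ((-1 : ℂ) ^ (w + U) * (w.factorial : ℂ) * ((U + P).factorial : ℂ)
    * (U.factorial : ℂ)) * hs

/-- the two expressions of `f_j` coincide (Lemma 4.14). -/
theorem stmt17 (N a : ℕ) (m : ℤ) (hm : (N : ℤ) < m) (ha : m - (N : ℤ) ≤ (a : ℤ))
    (q : ℤ) (hq1 : max 0 ((N : ℤ) - a + m) ≤ q) (hq2 : q ≤ 2 * N)
    (j : ℕ) (hj : j ≤ N) (hja : m ≤ (a : ℤ) + (j : ℤ)) :
    C (gratio (((N : ℂ) + 1 - (a : ℂ) - (q : ℂ)) + ((((a : ℤ) - m - 1) / 2 : ℤ) : ℂ))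
        (((a : ℤ) + m + (j : ℤ) - 1) / 2 - ((a : ℤ) - m - 1) / 2)) *
      ∑ r ∈ Finset.range (N - j + 1),
        C (Cp ((N : ℂ) + 1 - (a : ℂ) - (q : ℂ)) a N m j r) *
          gegenCit (((N : ℂ) + 1 - (a : ℂ) - (q : ℂ)) + (N : ℂ) - 1 - (r : ℂ))
            ((a : ℤ) + m - 2 * (N : ℤ) + (j : ℤ) + 2 * (r : ℤ))
    = C (gratio (((N : ℂ) + 1 - (a : ℂ) - (q : ℂ)) + ((((a : ℤ) - m - 1) / 2 : ℤ) : ℂ))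
        (((a : ℤ) - m + (j : ℤ) - 1) / 2 + q - (N : ℤ) - ((a : ℤ) - m - 1) / 2)) *
      ∑ r ∈ Finset.range (N - j + 1),
        C (Dc N m q j r) *
          gegenCit (((N : ℂ) + 1 - (a : ℂ) - (q : ℂ)) + (N : ℂ) - 1 - (r : ℂ))
            ((a : ℤ) - m + (j : ℤ) + 2 * (q - 2 * (N : ℤ) + (r : ℤ))) := by
  have hq0 : 0 ≤ q := le_trans (le_max_left _ _) hq1
  have hq3 : (N : ℤ) - a + m ≤ q := le_trans (le_max_right _ _) hq1
  clear hq1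
  set x0 : ℤ := (N : ℤ) + 1 - a - q + ((a : ℤ) - m - 1) / 2 with hx0
  have hx0c : ((N : ℂ) + 1 - (a : ℂ) - (q : ℂ)) + ((((a : ℤ) - m - 1) / 2 : ℤ) : ℂ) = (x0 : ℂ) := by
    rw [hx0]; push_cast; ring
  have hx0n : x0 ≤ 0 := by omega
  rw [hx0c]
  set k1 : ℤ := ((a : ℤ) + m + (j : ℤ) - 1) / 2 - ((a : ℤ) - m - 1) / 2 with hk1
  set k2 : ℤ := ((a : ℤ) - m + (j : ℤ) - 1) / 2 + q - (N : ℤ) - ((a : ℤ) - m - 1) / 2 with hk2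
  set μ : ℂ := ((N : ℂ) + 1 - (a : ℂ) - (q : ℂ)) + (N : ℂ) - 1 with hμ
  have hrl : ∀ r : ℕ, (a : ℤ) - m + (j : ℤ) + 2 * (q - 2 * (N : ℤ) + (r : ℤ))
      = ((a : ℤ) - m + (j : ℤ) + 2 * (q - 2 * (N : ℤ))) + 2 * (r : ℤ) := by intro r; ring
  simp only [hrl]
  set l1 : ℤ := (a : ℤ) + m - 2 * (N : ℤ) + (j : ℤ) with hl1
  set l2 : ℤ := (a : ℤ) - m + (j : ℤ) + 2 * (q - 2 * (N : ℤ)) with hl2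
  have hNj : ((N - j : ℕ) : ℤ) = (N : ℤ) - j := by omega
  ext p
  rw [coeff_C_mul, coeff_C_mul]
  by_cases h1 : ∃ U : ℕ, l1 + 2 * ((N - j : ℕ) : ℤ) = p + 2 * U
  · obtain ⟨U, hU⟩ := h1
    have hp : (p : ℤ) = (p / 2 : ℕ) + ((p + 1) / 2 : ℕ) := by omega
    have hp2 : (p : ℤ) = 2 * (p / 2 : ℕ) + (p % 2 : ℕ) := by omega
    have hL1 : μ + U - (N - j : ℕ) + ((p + 1) / 2 : ℕ) = (x0 : ℂ) + k1 := by
      have : (2 * (N : ℤ) - a - q) + U - (N - j : ℕ) + ((p + 1) / 2 : ℕ) = x0 + k1 := by omega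
      rw [← Int.cast_add, ← this, hμ]
      simp only [Int.cast_add, Int.cast_sub, Int.cast_mul, Int.cast_natCast, Int.cast_ofNat]
      ring
    have hS1 := sum_coeff N j hj ((N : ℂ) - m) ((N : ℂ) + 1 - (a : ℂ) - (q : ℂ) + a - N - 1) μ l1 p U hU
    rw [hL1] at hS1
    unfold Cp Dc
    rw [hS1]
    by_cases h2 : m + N - q ≤ U
    · obtain ⟨W, hW⟩ : ∃ W : ℕ, (W : ℤ) = U - (m + N - q) :=
        ⟨(U - (m + N - q)).toNat, by omega⟩
      have hW2 : l2 + 2 * ((N - j : ℕ) : ℤ) = p + 2 * W := by omega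
      have hS2 := sum_coeff N j hj ((N : ℂ) + m) ((q : ℂ) - 2 * N) μ l2 p W hW2
      have hL2 : μ + W - (N - j : ℕ) + ((p + 1) / 2 : ℕ) = (x0 : ℂ) + k2 := by
        have : (2 * (N : ℤ) - a - q) + W - (N - j : ℕ) + ((p + 1) / 2 : ℕ) = x0 + k2 := by omega
        rw [← Int.cast_add, ← this, hμ]
        simp only [Int.cast_add, Int.cast_sub, Int.cast_mul, Int.cast_natCast, Int.cast_ofNat]
        ring
      rw [hL2] at hS2
      rw [hS2]
      have g1 := gr_val x0 k1 (p / 2) W hx0n (by omega)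
      have g2 := gr_val x0 k2 (p / 2) U hx0n (by omega)
      have hWc : (W : ℂ) = U - (m + N - q) := by exact_mod_cast hW
      have hT : TT (N - j) (-((N : ℂ) - m)) ((N : ℂ) + 1 - (a : ℂ) - (q : ℂ) + a - N - 1)
            (-(2 * N)) (U - (N - j : ℕ) + 1)
          = TT (N - j) (-((N : ℂ) + m)) ((q : ℂ) - 2 * N) (-(2 * N)) (W - (N - j : ℕ) + 1) := by
        rw [TT_transf, hWc]
        congr 1 <;> ring
      rw [hT]
      set Q := TT (N - j) (-((N : ℂ) + m)) ((q : ℂ) - 2 * N) (-(2 * N)) (W - (N - j : ℕ) + 1)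
      set E := Complex.I ^ p * 2 ^ p / (p.factorial : ℂ)
      rw [pow_add] at g1 g2
      linear_combination (E * Q * ((-1) ^ U / (U.factorial : ℂ))) * g1
        - (E * Q * ((-1) ^ W / (W.factorial : ℂ))) * g2
    · rw [sum_coeff_zero]
      · have g1 := gr_zero x0 k1 (p / 2) hx0n (by omega) (by omega)
        rw [mul_zero]
        linear_combination (Complex.I ^ p * 2 ^ p / (p.factorial : ℂ) * ((-1) ^ U / (U.factorial : ℂ))
          * TT (N - j) (-((N : ℂ) - m)) ((N : ℂ) + 1 - (a : ℂ) - (q : ℂ) + a - N - 1)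
            (-(2 * N)) (U - (N - j : ℕ) + 1)) * g1
      · rintro ⟨W, hW⟩
        omega
  · rw [sum_coeff_zero _ _ _ _ _ h1, sum_coeff_zero, mul_zero, mul_zero]
    rintro ⟨W, hW⟩
    exact h1 ⟨(W + (m + N - q)).toNat, by omega⟩
end
end
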